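/- Let k be a field of characteristic 0, let 1 ≤ r ≤ n−1, and let q ∈ k be nonzero, either generic (not a root of unity) or a primitive m-th root of unity. Then the image of the quantum determinant d = d_r in M^{r+1}_q(n) = M_q(n)/I^{r+1}_q is a regular element, i.e., neither a left nor a right zero divisor. -/

import Mathlib

open scoped BigOperators

/-- Defining relations of the quantized matrix algebra `M_q(n,r)` (generators `Z (i,j)`). -/
inductive QMatRel (k : Type) [Field k] (q : k) (n r : ℕ) :
    FreeAlgebra k (Fin n × Fin r) → FreeAlgebra k (Fin n × Fin r) → Prop
  | row (i : Fin n) (j l : Fin r) (h : j < l) :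
      QMatRel k q n r (FreeAlgebra.ι k (i, j) * FreeAlgebra.ι k (i, l))
        (q • (FreeAlgebra.ι k (i, l) * FreeAlgebra.ι k (i, j)))
  | col (i s : Fin n) (j : Fin r) (h : i < s) :
      QMatRel k q n r (FreeAlgebra.ι k (i, j) * FreeAlgebra.ι k (s, j))
        (q • (FreeAlgebra.ι k (s, j) * FreeAlgebra.ι k (i, j)))
  | cross (i s : Fin n) (j l : Fin r) (h1 : i < s) (h2 : l < j) :
      QMatRel k q n r (FreeAlgebra.ι k (i, j) * FreeAlgebra.ι k (s, l))
        (FreeAlgebra.ι k (s, l) * FreeAlgebra.ι k (i, j))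
  | diag (i s : Fin n) (j l : Fin r) (h1 : i < s) (h2 : j < l) :
      QMatRel k q n r (FreeAlgebra.ι k (i, j) * FreeAlgebra.ι k (s, l))
        (FreeAlgebra.ι k (s, l) * FreeAlgebra.ι k (i, j) +
          (q - q⁻¹) • (FreeAlgebra.ι k (i, l) * FreeAlgebra.ι k (s, j)))

/-- The quantized matrix algebra `M_q(n,r)`. -/
abbrev QMat (k : Type) [Field k] (q : k) (n r : ℕ) : Type := RingQuot (QMatRel k q n r)

/-- The generator `Z_{i,j}` of `M_q(n,r)`. -/
noncomputable def Zgen (k : Type) [Field k] (q : k) (n r : ℕ) (i : Fin n) (j : Fin r) :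
    QMat k q n r :=
  RingQuot.mkAlgHom k (QMatRel k q n r) (FreeAlgebra.ι k (i, j))

/-- Number of inversions (the length) of a permutation. -/
def invCount {t : ℕ} (σ : Equiv.Perm (Fin t)) : ℕ :=
  (Finset.univ.filter (fun p : Fin t × Fin t => p.1 < p.2 ∧ σ p.2 < σ p.1)).card

/-- The `t × t` quantum minor on rows `row 0 < ... < row (t-1)` and columns
`col 0 < ... < col (t-1)`. -/
noncomputable def qMinor (k : Type) [Field k] (q : k) (n r : ℕ) (t : ℕ)
    (row : Fin t → Fin n) (col : Fin t → Fin r) : QMat k q n r :=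
  ∑ σ : Equiv.Perm (Fin t),
    ((-q) ^ invCount σ) • (List.ofFn fun a => Zgen k q n r (row a) (col (σ a))).prod

/-- The set of all `t × t` quantum minors of `M_q(n)` (rows `ro 0 < ... < ro (t-1)`,
columns `co 0 < ... < co (t-1)`). -/
def minorSet (k : Type) [Field k] (q : k) (n t : ℕ) : Set (QMat k q n n) :=
  {x | ∃ ro co : Fin t → Fin n, StrictMono ro ∧ StrictMono co ∧ x = qMinor k q n n t ro co}

/-- The relation identifying every `t × t` quantum minor of `M_q(n)` with `0`; the
corresponding `RingQuot` is the quotient of `M_q(n)` by the two-sided ideal `I^t_q`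
generated by all `t × t` quantum minors. -/
def minorRel (k : Type) [Field k] (q : k) (n t : ℕ) :
    QMat k q n n → QMat k q n n → Prop :=
  fun a b => a ∈ minorSet k q n t ∧ b = 0

/-- The quantized function algebra `M^{r+1}_q(n) = M_q(n) / I^{r+1}_q` of rank `r`
matrices. -/
abbrev QMatRank (k : Type) [Field k] (q : k) (n r : ℕ) : Type :=
  RingQuot (minorRel k q n (r + 1))

/-- The quotient map `π : M_q(n) → M^{r+1}_q(n)`. -/
noncomputable def rankProj (k : Type) [Field k] (q : k) (n r : ℕ) :
    QMat k q n n →ₐ[k] QMatRank k q n r :=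
  RingQuot.mkAlgHom k (minorRel k q n (r + 1))

/-- The quantum minor `d = d_r`: the `r × r` quantum minor of `M_q(n)` on rows and
columns `1, ..., r`. -/
noncomputable def dMinor (k : Type) [Field k] (q : k) (n r : ℕ) (h : r ≤ n) :
    QMat k q n n :=
  qMinor k q n n r (fun a => Fin.castLE h a) (fun a => Fin.castLE h a)

/-- `q` is either generic (not a root of unity) or a primitive `m`-th root of unity for
some `m ≥ 1`. -/
def GenericOrRootOfUnity (k : Type) [Field k] (q : k) : Prop :=
  (∀ m : ℕ, 0 < m → q ^ m ≠ 1) ∨ ∃ m : ℕ, 0 < m ∧ IsPrimitiveRoot q m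

namespace QuantumDet

section QMatrix

variable {k A ι κ τ : Type*} [Field k] [Ring A] [Algebra k A]
  [LinearOrder ι] [LinearOrder κ] [LinearOrder τ]

/-- The entries of `Z` satisfy the defining relations of quantized matrices. -/
structure IsQMatrix (q : k) (Z : ι → κ → A) : Prop where
  row : ∀ i j l, j < l → Z i j * Z i l = q • (Z i l * Z i j)
  col : ∀ i s j, i < s → Z i j * Z s j = q • (Z s j * Z i j)
  cross : ∀ i s j l, i < s → l < j → Z i j * Z s l = Z s l * Z i j
  diag : ∀ i s j l, i < s → j < l →
    Z i j * Z s l = Z s l * Z i j + (q - q⁻¹) • (Z i l * Z s j)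

theorem IsQMatrix.transpose {q : k} {Z : ι → κ → A} (h : IsQMatrix q Z) :
    IsQMatrix q (fun j i => Z i j) where
  row i j l hjl := h.col j l i hjl
  col i s j his := h.row j i s his
  cross i s j l his hlj := (h.cross l j s i hlj his).symm
  diag i s j l his hjl := by
    rw [h.diag j l i s hjl his, h.cross j l s i hjl his]

theorem IsQMatrix.submatrix {ι' κ' : Type*} [LinearOrder ι'] [LinearOrder κ'] {q : k}
    {Z : ι → κ → A} (h : IsQMatrix q Z) {f : ι' → ι} {g : κ' → κ} (hf : StrictMono f)
    (hg : StrictMono g) : IsQMatrix q (fun i j => Z (f i) (g j)) where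
  row _ _ _ hjl := h.row _ _ _ (hg hjl)
  col _ _ _ his := h.col _ _ _ (hf his)
  cross _ _ _ _ his hlj := h.cross _ _ _ _ (hf his) (hg hlj)
  diag _ _ _ _ his hjl := h.diag _ _ _ _ (hf his) (hg hjl)

theorem sum_sum_eq_zero_of_antisymm [CharZero k] {s : Finset κ} (G : κ → κ → A)
    (h0 : ∀ c, G c c = 0) (h1 : ∀ c d, c < d → G c d + G d c = 0) :
    ∑ c ∈ s, ∑ d ∈ s, G c d = 0 := by
  have h2 : ∀ c d, G c d + G d c = 0 := by
    intro c d
    rcases lt_trichotomy c d with h | h | h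
    · exact h1 c d h
    · subst h; simp [h0]
    · rw [add_comm]; exact h1 d c h
  have h3 : (∑ c ∈ s, ∑ d ∈ s, G c d) + ∑ c ∈ s, ∑ d ∈ s, G c d = 0 := by
    nth_rewrite 1 [Finset.sum_comm]
    rw [← Finset.sum_add_distrib]
    refine Finset.sum_eq_zero fun c _ => ?_
    rw [← Finset.sum_add_distrib]
    exact Finset.sum_eq_zero fun d _ => h2 _ _
  have h4 : (2 : k) • (∑ c ∈ s, ∑ d ∈ s, G c d) = 0 := by rw [two_smul, h3]
  exact (smul_eq_zero.mp h4).resolve_left two_ne_zero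

theorem IsQMatrix.mul [CharZero k] {q : k} (hq : q ≠ 0) {X : ι → κ → A} {Y : κ → τ → A}
    (hX : IsQMatrix q X) (hY : IsQMatrix q Y)
    (hXY : ∀ i c d j, X i c * Y d j = Y d j * X i c) (s : Finset κ) :
    IsQMatrix q (fun i j => ∑ c ∈ s, X i c * Y c j) := by
  have key : ∀ i j i' j', (∑ c ∈ s, X i c * Y c j) * (∑ c ∈ s, X i' c * Y c j') =
      ∑ c ∈ s, ∑ d ∈ s, (X i c * X i' d) * (Y c j * Y d j') := by
    intro i j i' j'
    rw [Finset.sum_mul_sum]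
    refine Finset.sum_congr rfl fun c _ => Finset.sum_congr rfl fun d _ => ?_
    rw [mul_assoc, ← mul_assoc (Y c j), ← hXY, mul_assoc, mul_assoc]
  refine ⟨?_, ?_, ?_, ?_⟩
  · intro i j l hjl
    simp only [key]
    rw [← sub_eq_zero, Finset.smul_sum, ← Finset.sum_sub_distrib]
    simp only [Finset.smul_sum, ← Finset.sum_sub_distrib]
    apply sum_sum_eq_zero_of_antisymm (k := k)
    · intro c
      rw [hY.row c j l hjl, mul_smul_comm, sub_self]
    · intro c d hcd
      rw [hX.row i c d hcd, hY.diag c d j l hcd hjl, ← hY.cross c d l j hcd hjl]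
      simp only [mul_add, smul_mul_assoc, mul_smul_comm, smul_smul, mul_sub, sub_smul,
        inv_mul_cancel₀ hq, one_smul]
      abel
  · intro i s' j his
    simp only [key]
    rw [← sub_eq_zero, Finset.smul_sum, ← Finset.sum_sub_distrib]
    simp only [Finset.smul_sum, ← Finset.sum_sub_distrib]
    apply sum_sum_eq_zero_of_antisymm (k := k)
    · intro c
      rw [hX.col i s' c his, smul_mul_assoc, sub_self]
    · intro c d hcd
      rw [hY.col c d j hcd, hX.diag i s' c d his hcd, ← hX.cross i s' d c his hcd]
      simp only [add_mul, mul_smul_comm, smul_mul_assoc, smul_add, smul_smul, sub_mul,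
        smul_sub, sub_smul, mul_inv_cancel₀ hq, one_smul]
      abel
  · intro i s' j l his hlj
    simp only [key]
    rw [← sub_eq_zero, ← Finset.sum_sub_distrib]
    simp only [← Finset.sum_sub_distrib]
    apply sum_sum_eq_zero_of_antisymm (k := k)
    · intro c
      rw [hX.col i s' c his, hY.row c l j hlj, mul_smul_comm, smul_mul_assoc, sub_self]
    · intro c d hcd
      rw [hX.diag i s' c d his hcd, hY.diag c d l j hcd hlj, ← hX.cross i s' d c his hcd,
        hY.cross c d j l hcd hlj]
      simp only [add_mul, mul_add, smul_mul_assoc, mul_smul_comm]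
      abel
  · intro i s' j l his hjl
    simp only [key]
    rw [← sub_eq_zero, ← sub_sub, Finset.smul_sum, ← Finset.sum_sub_distrib,
      ← Finset.sum_sub_distrib]
    simp only [Finset.smul_sum, ← Finset.sum_sub_distrib]
    apply sum_sum_eq_zero_of_antisymm (k := k)
    · intro c
      rw [hX.col i s' c his, hY.row c j l hjl]
      simp only [smul_mul_assoc, mul_smul_comm, sub_smul, smul_smul, inv_mul_cancel₀ hq,
        sub_mul, one_smul]
      abel
    · intro c d hcd
      rw [hX.diag i s' c d his hcd, hY.diag c d j l hcd hjl, ← hX.cross i s' d c his hcd,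
        hY.cross c d l j hcd hjl]
      generalize q - q⁻¹ = h
      simp only [add_mul, mul_add, smul_mul_assoc, mul_smul_comm, smul_add]
      abel

theorem isQMatrix_ite_eq (q : k) :
    IsQMatrix q (fun i j : ℕ => if i = j then (1 : A) else 0) where
  row i j l h := by split_ifs <;> first | omega | simp
  col i s j h := by split_ifs <;> first | omega | simp
  cross i s j l h h' := by split_ifs <;> first | omega | simp
  diag i s j l h h' := by split_ifs <;> first | omega | simp

theorem isQMatrix_bidiagonal {q : k} {a b : ℕ → A}
    (haa : ∀ i j, a i * a j = a j * a i) (hbb : ∀ i j, b i * b j = b j * b i)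
    (hba : ∀ i, b i * a (i + 1) = q • (a (i + 1) * b i))
    (hab : ∀ i, a i * b i = q • (b i * a i))
    (hab' : ∀ i j, i ≠ j → i ≠ j + 1 → a i * b j = b j * a i) :
    IsQMatrix q (fun i j : ℕ => if i = j then a j else if i = j + 1 then b j else 0) where
  row i j l h := by
    split_ifs <;> first | omega | simp | skip
    subst_vars; exact hba _
  col i s j h := by
    split_ifs <;> first | omega | simp | skip
    subst_vars; exact hab _
  cross i s j l h h' := by
    split_ifs <;> first | omega | simp
  diag i s j l h h' := by
    split_ifs <;> first | omega | simp
    all_goals first | exact haa _ _ | exact hbb _ _ | skip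
    all_goals first
      | exact hab' _ _ (by omega) (by omega)
      | exact (hab' _ _ (by omega) (by omega)).symm

end QMatrix

section Minors

theorem invCount_one (t : ℕ) : invCount (1 : Equiv.Perm (Fin t)) = 0 := by
  rw [invCount, Finset.card_eq_zero, Finset.filter_eq_empty_iff]
  rintro ⟨x, y⟩ - ⟨h1, h2⟩
  exact absurd h1 (not_lt.mpr h2.le)

theorem invCount_mul_swap {t : ℕ} (σ : Equiv.Perm (Fin t)) {a b : Fin t}
    (hab : (b : ℕ) = a + 1) (h : σ a < σ b) :
    invCount (σ * Equiv.swap a b) = invCount σ + 1 := by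
  have hne : a ≠ b := fun e => by subst e; omega
  set s := Equiv.swap a b with hs
  have hsa : s a = b := Equiv.swap_apply_left a b
  have hsb : s b = a := Equiv.swap_apply_right a b
  have hss : ∀ x, s (s x) = x := fun x => Equiv.swap_apply_self a b x
  have hlt : ∀ x y, x < y → ¬ (x = a ∧ y = b) → s x < s y := by
    intro x y hxy hn
    simp only [hs, Equiv.swap_apply_def]
    split_ifs <;> simp only [Fin.lt_def, Fin.ext_iff] at * <;> omega
  have hinj : Function.Injective (fun p : Fin t × Fin t => (s p.1, s p.2)) := by
    rintro ⟨x, y⟩ ⟨x', y'⟩ hp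
    simpa using hp
  have key : Finset.univ.filter (fun p : Fin t × Fin t => p.1 < p.2 ∧ (σ * s) p.2 < (σ * s) p.1) =
      insert (a, b) ((Finset.univ.filter
        (fun p : Fin t × Fin t => p.1 < p.2 ∧ σ p.2 < σ p.1)).image
          (fun p => (s p.1, s p.2))) := by
    ext ⟨x, y⟩
    rw [Finset.mem_filter, Finset.mem_insert, Finset.mem_image]
    simp only [Finset.mem_filter, Finset.mem_univ, true_and, Equiv.Perm.mul_apply,
      Prod.mk.injEq, Prod.exists]
    constructor
    · rintro ⟨h1, h2⟩
      by_cases hxy : x = a ∧ y = b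
      · exact Or.inl hxy
      · exact Or.inr ⟨s x, s y, ⟨hlt x y h1 hxy, h2⟩, hss x, hss y⟩
    · rintro (⟨rfl, rfl⟩ | ⟨x', y', ⟨h1, h2⟩, rfl, rfl⟩)
      · rw [hsa, hsb]
        refine ⟨?_, h⟩
        rw [Fin.lt_def]; omega
      · rw [hss, hss]
        refine ⟨hlt _ _ h1 ?_, h2⟩
        rintro ⟨rfl, rfl⟩
        exact absurd h (not_lt.mpr h2.le)
  rw [invCount, key, Finset.card_insert_of_notMem, Finset.card_image_of_injective _ hinj, invCount]
  simp only [Finset.mem_image, Finset.mem_filter, Finset.mem_univ, true_and, Prod.mk.injEq,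
    Prod.exists, not_exists, not_and]
  rintro x y ⟨h1, -⟩ hx hy
  have hx' : x = b := by rw [← hss x, hx, hsa]
  have hy' : y = a := by rw [← hss y, hy, hsb]
  subst hx' hy'
  rw [Fin.lt_def] at h1; omega

theorem prod_ofFn_split {M : Type*} [Monoid M] {t : ℕ} {a b : Fin t} (hab : (b : ℕ) = a + 1)
    (f : Fin t → M) : (List.ofFn f).prod =
      ((List.ofFn f).take a).prod * (f a * f b) * ((List.ofFn f).drop (b + 1)).prod := by
  have hb := b.2
  rw [← List.prod_take_mul_prod_drop (List.ofFn f) a,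
    List.drop_eq_getElem_cons (by simp), List.prod_cons]
  have : (List.ofFn f).drop (a + 1) = f b :: (List.ofFn f).drop (b + 1) := by
    rw [← hab, List.drop_eq_getElem_cons (by simp)]
    simp
  rw [this, List.prod_cons]
  simp [mul_assoc]

theorem take_ofFn_congr {M : Type*} {t : ℕ} {a : Fin t} {f g : Fin t → M}
    (h : ∀ x < a, f x = g x) : (List.ofFn f).take a = (List.ofFn g).take a := by
  apply List.ext_getElem
  · simp
  · intro i h1 h2
    simp only [List.getElem_take, List.getElem_ofFn]
    apply h
    rw [List.length_take] at h1
    rw [Fin.lt_def]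
    exact lt_of_lt_of_le h1 (min_le_left _ _)

theorem drop_ofFn_congr {M : Type*} {t : ℕ} {b : Fin t} {f g : Fin t → M}
    (h : ∀ x, b < x → f x = g x) :
    (List.ofFn f).drop (b + 1) = (List.ofFn g).drop (b + 1) := by
  apply List.ext_getElem
  · simp
  · intro i h1 h2
    simp only [List.getElem_drop, List.getElem_ofFn]
    apply h
    rw [Fin.lt_def]
    simp; omega

variable {k A ι κ : Type*} [Field k] [Ring A] [Algebra k A]

/-- The quantum minor of a matrix `Z` on the given families of rows and columns. -/
noncomputable def qdet (q : k) (Z : ι → κ → A) {t : ℕ} (row : Fin t → ι) (col : Fin t → κ) : A :=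
  ∑ σ : Equiv.Perm (Fin t),
    ((-q) ^ invCount σ) • (List.ofFn fun a => Z (row a) (col (σ a))).prod

theorem sum_perm_eq_zero [CharZero k] {t : ℕ} {a b : Fin t} (hne : a ≠ b)
    (f : Equiv.Perm (Fin t) → A)
    (h : ∀ σ : Equiv.Perm (Fin t), σ a < σ b → f σ + f (σ * Equiv.swap a b) = 0) :
    ∑ σ, f σ = 0 := by
  have h2 : ∀ σ : Equiv.Perm (Fin t), f σ + f (σ * Equiv.swap a b) = 0 := by
    intro σ
    rcases lt_trichotomy (σ a) (σ b) with h1 | h1 | h1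
    · exact h σ h1
    · exact absurd (σ.injective h1) hne
    · have := h (σ * Equiv.swap a b) (by simpa using h1)
      rw [mul_assoc, Equiv.swap_mul_self, mul_one] at this
      rw [add_comm]; exact this
  have h3 : ∑ σ, f (σ * Equiv.swap a b) = ∑ σ, f σ :=
    Equiv.sum_comp (Equiv.mulRight (Equiv.swap a b)) f
  have h4 : (2 : k) • (∑ σ, f σ) = 0 := by
    rw [two_smul]
    nth_rewrite 2 [← h3]
    rw [← Finset.sum_add_distrib]
    exact Finset.sum_eq_zero fun σ _ => h2 σ
  exact (smul_eq_zero.mp h4).resolve_left two_ne_zero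

theorem IsQMatrix.qdet_eq_zero_of_adjacent_eq [LinearOrder ι] [LinearOrder κ] [CharZero k] {q : k}
    {Z : ι → κ → A}
    (hZ : IsQMatrix q Z) {t : ℕ} {a b : Fin t} (hab : (b : ℕ) = a + 1) {row : Fin t → ι}
    {col : Fin t → κ} (hcol : StrictMono col) (hrow : row a = row b) :
    qdet q Z row col = 0 := by
  have hne : a ≠ b := fun e => by subst e; omega
  apply sum_perm_eq_zero (k := k) hne
  intro σ hσ
  rw [invCount_mul_swap σ hab hσ, prod_ofFn_split hab, prod_ofFn_split hab,
    take_ofFn_congr (f := fun x => Z (row x) (col ((σ * Equiv.swap a b) x)))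
      (g := fun x => Z (row x) (col (σ x))),
    drop_ofFn_congr (f := fun x => Z (row x) (col ((σ * Equiv.swap a b) x)))
      (g := fun x => Z (row x) (col (σ x)))]
  · simp only [Equiv.Perm.coe_mul, Function.comp_apply, Equiv.swap_apply_left,
      Equiv.swap_apply_right, hrow, hZ.row _ _ _ (hcol hσ), pow_succ, smul_mul_assoc,
      mul_smul_comm, smul_smul, mul_neg, neg_smul]
    rw [add_neg_cancel]
  · intro x hx
    rw [Equiv.Perm.mul_apply, Equiv.swap_apply_of_ne_of_ne] <;>
    · rintro rfl; rw [Fin.lt_def] at hx; omega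
  · intro x hx
    rw [Equiv.Perm.mul_apply, Equiv.swap_apply_of_ne_of_ne] <;>
    · rintro rfl; rw [Fin.lt_def] at hx; omega

theorem IsQMatrix.qdet_comp_swap [LinearOrder ι] [LinearOrder κ] [CharZero k] {q : k} (hq : q ≠ 0)
    {Z : ι → κ → A}
    (hZ : IsQMatrix q Z) {t : ℕ} {a b : Fin t} (hab : (b : ℕ) = a + 1) {row : Fin t → ι}
    {col : Fin t → κ} (hcol : StrictMono col) (hrow : row b < row a) :
    qdet q Z row col = -q • qdet q Z (row ∘ Equiv.swap a b) col := by
  have hne : a ≠ b := fun e => by subst e; omega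
  rw [← sub_eq_zero, qdet, qdet, Finset.smul_sum, ← Finset.sum_sub_distrib]
  apply sum_perm_eq_zero (k := k) hne
  intro σ hσ
  rw [invCount_mul_swap σ hab hσ, prod_ofFn_split hab, prod_ofFn_split hab, prod_ofFn_split hab,
    prod_ofFn_split hab,
    take_ofFn_congr (f := fun x => Z (row x) (col ((σ * Equiv.swap a b) x)))
      (g := fun x => Z (row x) (col (σ x))),
    drop_ofFn_congr (f := fun x => Z (row x) (col ((σ * Equiv.swap a b) x)))
      (g := fun x => Z (row x) (col (σ x))),
    take_ofFn_congr (f := fun x => Z ((row ∘ Equiv.swap a b) x) (col ((σ * Equiv.swap a b) x)))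
      (g := fun x => Z (row x) (col (σ x))),
    drop_ofFn_congr (f := fun x => Z ((row ∘ Equiv.swap a b) x) (col ((σ * Equiv.swap a b) x)))
      (g := fun x => Z (row x) (col (σ x))),
    take_ofFn_congr (f := fun x => Z ((row ∘ Equiv.swap a b) x) (col (σ x)))
      (g := fun x => Z (row x) (col (σ x))),
    drop_ofFn_congr (f := fun x => Z ((row ∘ Equiv.swap a b) x) (col (σ x)))
      (g := fun x => Z (row x) (col (σ x)))]
  · simp only [Equiv.Perm.coe_mul, Function.comp_apply, Equiv.swap_apply_left,
      Equiv.swap_apply_right]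
    rw [hZ.diag _ _ _ _ hrow (hcol hσ), ← hZ.cross _ _ _ _ hrow (hcol hσ)]
    simp only [smul_mul_assoc, mul_smul_comm, mul_add, add_mul]
    match_scalars <;> field_simp <;> ring
  all_goals
    intro x hx
    have h1 : x ≠ a := by rintro rfl; rw [Fin.lt_def] at hx; omega
    have h2 : x ≠ b := by rintro rfl; rw [Fin.lt_def] at hx; omega
    simp [Equiv.swap_apply_of_ne_of_ne h1 h2]

theorem IsQMatrix.qdet_eq_zero_of_not_injective [LinearOrder κ] [CharZero k] {q : k} (hq : q ≠ 0)
    {Z : ℕ → κ → A} (hZ : IsQMatrix q Z) {t : ℕ} {col : Fin t → κ} (hcol : StrictMono col)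
    (row : Fin t → ℕ) (hrow : ¬ Function.Injective row) : qdet q Z row col = 0 := by
  induction hN : ∑ x, (t - x) * row x using Nat.strong_induction_on generalizing row with
  | _ N ih =>
    subst hN
    by_cases hd : ∃ a b : Fin t, (b : ℕ) = a + 1 ∧ row b < row a
    · obtain ⟨a, b, hab, hlt⟩ := hd
      have hne : a ≠ b := fun e => by subst e; omega
      rw [hZ.qdet_comp_swap hq hab hcol hlt, ih _ _ _ _ rfl, smul_zero]
      · rw [← Finset.sum_erase_add _ _ (Finset.mem_univ a),
          ← Finset.sum_erase_add _ _ (Finset.mem_univ a),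
          ← Finset.sum_erase_add _ _ (Finset.mem_erase.mpr ⟨hne.symm, Finset.mem_univ b⟩),
          ← Finset.sum_erase_add (a := b) _ _ (Finset.mem_erase.mpr ⟨hne.symm, Finset.mem_univ b⟩)]
        have : ∀ x ∈ (Finset.univ.erase a).erase b,
            (t - x) * (row ∘ Equiv.swap a b) x = (t - x) * row x := by
          intro x hx
          simp only [Finset.mem_erase, Finset.mem_univ, and_true] at hx
          simp [Equiv.swap_apply_of_ne_of_ne hx.2 hx.1]
        rw [Finset.sum_congr rfl this]
        simp only [Function.comp_apply, Equiv.swap_apply_left, Equiv.swap_apply_right]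
        obtain ⟨c, hc⟩ : ∃ c, t - a = c + 1 ∧ t - b = c := ⟨t - b, by omega, rfl⟩
        rw [hc.1, hc.2, add_mul, add_mul]
        omega
      · intro hinj
        exact hrow ((Equiv.injective_comp (Equiv.swap a b) row).mp hinj)
    · push Not at hd
      by_cases he : ∃ a b : Fin t, (b : ℕ) = a + 1 ∧ row a = row b
      · obtain ⟨a, b, hab, heq⟩ := he
        exact hZ.qdet_eq_zero_of_adjacent_eq hab hcol heq
      · push Not at he
        exfalso
        apply hrow
        rcases t with _ | t
        · exact Function.injective_of_subsingleton _
        · refine (Fin.strictMono_iff_lt_succ.mpr fun i => ?_).injective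
          exact lt_of_le_of_ne (hd _ _ (by simp)) (he _ _ (by simp))

theorem prod_ofFn_mul {M : Type*} [Monoid M] {t : ℕ} (x y : Fin t → M)
    (h : ∀ a b, x a * y b = y b * x a) :
    (List.ofFn fun a => x a * y a).prod = (List.ofFn x).prod * (List.ofFn y).prod := by
  induction t with
  | zero => simp
  | succ t ih =>
    simp only [List.ofFn_succ, List.prod_cons]
    rw [ih _ _ fun a b => h _ _]
    have : Commute (y 0) (List.ofFn fun a : Fin t => x a.succ).prod := by
      refine Commute.list_prod_right _ _ ?_
      intro z hz
      obtain ⟨i, rfl⟩ := (List.mem_ofFn' _ _).mp hz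
      exact (h _ _).symm
    rw [mul_assoc, mul_assoc, ← mul_assoc (y 0), this.eq, mul_assoc]

theorem prod_ofFn_sum {t : ℕ} {s : Type*} [Fintype s] [DecidableEq s] (g : Fin t → s → A) :
    (List.ofFn fun a => ∑ c, g a c).prod =
      ∑ c : Fin t → s, (List.ofFn fun a => g a (c a)).prod := by
  have := (MultilinearMap.mkPiAlgebraFin ℤ t A).map_sum (fun a c => g a c)
  simpa using this

theorem qdet_mul {q : k} {r : ℕ} {X : ι → ℕ → A} {Y : ℕ → κ → A}
    (hXY : ∀ i c d j, X i c * Y d j = Y d j * X i c) {t : ℕ} (row : Fin t → ι) (col : Fin t → κ) :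
    qdet q (fun i j => ∑ c ∈ Finset.range r, X i c * Y c j) row col =
      ∑ c : Fin t → Fin r, (List.ofFn fun a => X (row a) (c a)).prod *
        qdet q Y (fun a => (c a : ℕ)) col := by
  simp only [qdet, Finset.sum_range, prod_ofFn_sum, Finset.mul_sum, Finset.smul_sum]
  rw [Finset.sum_comm]
  refine Finset.sum_congr rfl fun c _ => Finset.sum_congr rfl fun σ _ => ?_
  rw [prod_ofFn_mul _ _ fun a b => hXY _ _ _ _, mul_smul_comm]

theorem IsQMatrix.qdet_mul_eq_sum_injective [LinearOrder κ] [CharZero k] {q : k} (hq : q ≠ 0)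
    {r : ℕ}
    {X : ι → ℕ → A} {Y : ℕ → κ → A} (hY : IsQMatrix q Y)
    (hXY : ∀ i c d j, X i c * Y d j = Y d j * X i c) {t : ℕ} (row : Fin t → ι) {col : Fin t → κ}
    (hcol : StrictMono col) :
    qdet q (fun i j => ∑ c ∈ Finset.range r, X i c * Y c j) row col =
      ∑ c : Fin t ↪ Fin r, ∑ σ : Equiv.Perm (Fin t), ((-q) ^ invCount σ) •
        (List.ofFn fun a => X (row a) (c a) * Y (c a) (col (σ a))).prod := by
  classical
  rw [qdet_mul hXY]
  rw [← Finset.sum_subset (Finset.subset_univ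
    (Finset.univ.map ⟨fun c : Fin t ↪ Fin r => (c : Fin t → Fin r), DFunLike.coe_injective⟩))]
  · rw [Finset.sum_map]
    refine Finset.sum_congr rfl fun c _ => ?_
    rw [qdet, Finset.mul_sum]
    refine Finset.sum_congr rfl fun σ _ => ?_
    rw [prod_ofFn_mul _ _ fun a b => hXY _ _ _ _, mul_smul_comm]
    rfl
  · intro c _ hc
    rw [hY.qdet_eq_zero_of_not_injective hq hcol, mul_zero]
    intro hinj
    apply hc
    rw [Finset.mem_map]
    exact ⟨⟨c, fun x y hxy => hinj (by simp [hxy])⟩, Finset.mem_univ _, rfl⟩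

theorem IsQMatrix.qdet_mul_eq_zero [LinearOrder κ] [CharZero k] {q : k} (hq : q ≠ 0) {r : ℕ}
    {X : ι → ℕ → A} {Y : ℕ → κ → A} (hY : IsQMatrix q Y)
    (hXY : ∀ i c d j, X i c * Y d j = Y d j * X i c) {t : ℕ} (ht : r < t) (row : Fin t → ι)
    {col : Fin t → κ} (hcol : StrictMono col) :
    qdet q (fun i j => ∑ c ∈ Finset.range r, X i c * Y c j) row col = 0 := by
  rw [hY.qdet_mul_eq_sum_injective hq hXY row hcol]
  have : IsEmpty (Fin t ↪ Fin r) := ⟨fun f => by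
    have := Fintype.card_le_of_embedding f
    simp at this
    omega⟩
  simp

end Minors

section Torus

variable {k Γ A : Type*} [Field k] [AddCommMonoid Γ] [Ring A] [Algebra k A]

/-- `E` is a basis of a twisted monoid algebra with coordinates `ev`. -/
structure IsTorusBasis (q : k) (ω : Γ →+ Γ →+ ℤ) (E : Γ → A) (ev : A →ₗ[k] Γ →₀ k) : Prop where
  ne_zero : q ≠ 0
  zero : E 0 = 1
  mul : ∀ e e', E e * E e' = q ^ ω e e' • E (e + e')
  ev_apply : ∀ e, ev (E e) = Finsupp.single e 1

variable (k) in
/-- The span of the monomials of weight less than `W`. -/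
def lowSpan (E : Γ → A) (w : Γ →+ ℕ) (W : ℕ) : Submodule k A :=
  Submodule.span k (E '' {e | w e < W})

variable (k) in
/-- `f` is a nonzero multiple of the monomial `E e`, up to monomials of smaller weight. -/
def HasLead (E : Γ → A) (w : Γ →+ ℕ) (f : A) (e : Γ) : Prop :=
  ∃ c : k, c ≠ 0 ∧ f - c • E e ∈ lowSpan k E w (w e)

variable {q : k} {ω : Γ →+ Γ →+ ℤ} {E : Γ → A} {ev : A →ₗ[k] Γ →₀ k} {w : Γ →+ ℕ} {f g : A}
  {e e' : Γ}

theorem lowSpan_mono {W W' : ℕ} (h : W ≤ W') : lowSpan k E w W ≤ lowSpan k E w W' :=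
  Submodule.span_mono (Set.image_mono fun _ he => lt_of_lt_of_le he h)

theorem mem_lowSpan {W : ℕ} (h : w e < W) : E e ∈ lowSpan k E w W :=
  Submodule.subset_span ⟨e, h, rfl⟩

theorem lowSpan_le_span (W : ℕ) : lowSpan k E w W ≤ Submodule.span k (Set.range E) :=
  Submodule.span_mono (Set.image_subset_range _ _)

theorem hasLead_self (e : Γ) : HasLead k E w (E e) e :=
  ⟨1, one_ne_zero, by rw [one_smul, sub_self]; exact zero_mem _⟩

theorem HasLead.mem_lowSpan (hf : HasLead k E w f e) {W : ℕ} (hW : w e < W) :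
    f ∈ lowSpan k E w W := by
  obtain ⟨c, -, h⟩ := hf
  rw [← sub_add_cancel f (c • E e)]
  exact add_mem (lowSpan_mono hW.le h) (Submodule.smul_mem _ _ (QuantumDet.mem_lowSpan hW))

theorem HasLead.add (hf : HasLead k E w f e) (hg : g ∈ lowSpan k E w (w e)) :
    HasLead k E w (f + g) e := by
  obtain ⟨c, hc, h⟩ := hf
  refine ⟨c, hc, ?_⟩
  rw [add_sub_right_comm]
  exact add_mem h hg

theorem HasLead.smul (hf : HasLead k E w f e) {a : k} (ha : a ≠ 0) :
    HasLead k E w (a • f) e := by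
  obtain ⟨c, hc, h⟩ := hf
  refine ⟨a * c, mul_ne_zero ha hc, ?_⟩
  rw [mul_smul, ← smul_sub]
  exact Submodule.smul_mem _ _ h

namespace IsTorusBasis

theorem mul_comm (hE : IsTorusBasis q ω E ev) (e e' : Γ) :
    E e * E e' = q ^ (ω e e' - ω e' e) • (E e' * E e) := by
  rw [hE.mul, hE.mul, smul_smul, ← zpow_add₀ hE.ne_zero, sub_add_cancel, add_comm]

theorem mul_mem_span (hE : IsTorusBasis q ω E ev) (hf : f ∈ Submodule.span k (Set.range E))
    (hg : g ∈ Submodule.span k (Set.range E)) : f * g ∈ Submodule.span k (Set.range E) := by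
  have hle : Submodule.span k (Set.range E) * Submodule.span k (Set.range E)
      ≤ Submodule.span k (Set.range E) := by
    rw [Submodule.span_mul_span, Submodule.span_le]
    rintro _ ⟨_, ⟨e, rfl⟩, _, ⟨e', rfl⟩, rfl⟩
    simp only [hE.mul]
    exact Submodule.smul_mem _ _ (Submodule.subset_span ⟨_, rfl⟩)
  exact hle (Submodule.mul_mem_mul hf hg)

theorem mul_mem_lowSpan (hE : IsTorusBasis q ω E ev) {a b c : ℕ} (h : a + b ≤ c + 1)
    (hf : f ∈ lowSpan k E w a) (hg : g ∈ lowSpan k E w b) : f * g ∈ lowSpan k E w c := by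
  have hle : lowSpan k E w a * lowSpan k E w b ≤ lowSpan k E w c := by
    rw [lowSpan, lowSpan, Submodule.span_mul_span, Submodule.span_le]
    rintro _ ⟨_, ⟨e, he, rfl⟩, _, ⟨e', he', rfl⟩, rfl⟩
    change w e < a at he
    change w e' < b at he'
    simp only [hE.mul]
    refine Submodule.smul_mem _ _ (mem_lowSpan ?_)
    rw [map_add]
    omega
  exact hle (Submodule.mul_mem_mul hf hg)

theorem hasLead_one (hE : IsTorusBasis q ω E ev) : HasLead k E w 1 0 := by
  rw [← hE.zero]
  exact hasLead_self 0

theorem hasLead_mul (hE : IsTorusBasis q ω E ev) (hf : HasLead k E w f e)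
    (hg : HasLead k E w g e') : HasLead k E w (f * g) (e + e') := by
  have hg' := hg.mem_lowSpan (Nat.lt_succ_self _)
  obtain ⟨c, hc, h⟩ := hf
  obtain ⟨c', hc', h'⟩ := hg
  refine ⟨c * c' * q ^ ω e e',
    mul_ne_zero (mul_ne_zero hc hc') (zpow_ne_zero _ hE.ne_zero), ?_⟩
  have : f * g - (c * c' * q ^ ω e e') • E (e + e') =
      (f - c • E e) * g + c • (E e * (g - c' • E e')) := by
    rw [sub_mul, mul_sub, mul_smul_comm, hE.mul, smul_mul_assoc, smul_sub, smul_smul,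
      smul_smul, mul_assoc]
    abel
  rw [this, map_add]
  exact add_mem (hE.mul_mem_lowSpan (by omega) h hg') (Submodule.smul_mem _ _
    (hE.mul_mem_lowSpan (by omega) (mem_lowSpan (Nat.lt_succ_self _)) h'))

theorem hasLead_prod_ofFn (hE : IsTorusBasis q ω E ev) {t : ℕ} {f : Fin t → A} {e : Fin t → Γ}
    (h : ∀ a, HasLead k E w (f a) (e a)) : HasLead k E w (List.ofFn f).prod (∑ a, e a) := by
  induction t with
  | zero => simpa using hE.hasLead_one
  | succ t ih =>
    rw [List.ofFn_succ, List.prod_cons, Fin.sum_univ_succ]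
    exact hE.hasLead_mul (h 0) (ih fun a => h a.succ)

theorem hasLead_prod_map (hE : IsTorusBasis q ω E ev) {S : Type*} (l : List S) {f : S → A}
    {e : S → Γ} (h : ∀ a ∈ l, HasLead k E w (f a) (e a)) :
    HasLead k E w (l.map f).prod (l.map e).sum := by
  induction l with
  | nil => simpa using hE.hasLead_one
  | cons a l ih =>
    rw [List.map_cons, List.prod_cons, List.map_cons, List.sum_cons]
    exact hE.hasLead_mul (h a (by simp)) (ih fun b hb => h b (by simp [hb]))

theorem ev_apply_of_mem_lowSpan (hE : IsTorusBasis q ω E ev) {W : ℕ} (hf : f ∈ lowSpan k E w W)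
    (he : W ≤ w e) : ev f e = 0 := by
  induction hf using Submodule.span_induction with
  | mem x hx =>
    obtain ⟨e', he', rfl⟩ := hx
    change w e' < W at he'
    rw [hE.ev_apply, Finsupp.single_apply_eq_zero]
    rintro rfl
    omega
  | zero => simp
  | add x y _ _ hx hy => simp [hx, hy]
  | smul a x _ hx => simp [hx]

theorem linearIndependent_of_hasLead (hE : IsTorusBasis q ω E ev) {S : Type*} {f : S → A}
    {e : S → Γ} (he : Function.Injective e) (h : ∀ i, HasLead k E w (f i) (e i)) :
    LinearIndependent k f := by
  classical
  rw [linearIndependent_iff']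
  intro s g hg
  by_contra! hne
  obtain ⟨i, hi, hmax⟩ := (s.filter (g · ≠ 0)).exists_max_image (fun i => w (e i))
    (by obtain ⟨i, hi, hgi⟩ := hne; exact ⟨i, by simp [hi, hgi]⟩)
  simp only [Finset.mem_filter] at hi hmax
  have h1 := congrArg (fun F : A => ev F (e i)) hg
  simp only [map_sum, map_smul, Finsupp.coe_finsetSum, Finset.sum_apply,
    Finsupp.smul_apply, map_zero, Finsupp.coe_zero, Pi.zero_apply] at h1
  have h2 : ∀ j ∈ s, g j ≠ 0 → ∃ c : k, c ≠ 0 ∧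
      ev (f j) (e i) = c * Finsupp.single (e j) 1 (e i) := by
    intro j hj hgj
    obtain ⟨c, hc, hl⟩ := h j
    refine ⟨c, hc, ?_⟩
    have h2 := hE.ev_apply_of_mem_lowSpan hl (hmax j ⟨hj, hgj⟩)
    rw [map_sub, map_smul, hE.ev_apply, Finsupp.sub_apply, sub_eq_zero] at h2
    rw [h2, Finsupp.smul_apply, smul_eq_mul]
  rw [Finset.sum_eq_single i] at h1
  · obtain ⟨c, hc, h3⟩ := h2 i hi.1 hi.2
    rw [h3] at h1
    simp [hi.2, hc] at h1
  · intro j hj hji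
    by_cases hgj : g j = 0
    · simp [hgj]
    obtain ⟨c, hc, h3⟩ := h2 j hj hgj
    have : e j ≠ e i := fun hh => hji (he hh)
    simp [h3, this]
  · exact fun hn => absurd hi.1 hn

theorem eq_zero_of_mul_eq_zero_left [IsCancelAdd Γ] (hE : IsTorusBasis q ω E ev)
    (hf : HasLead k E w f e) (hg : g ∈ Submodule.span k (Set.range E)) (h : f * g = 0) : g = 0 := by
  obtain ⟨c, rfl⟩ := Finsupp.mem_span_range_iff_exists_finsupp.mp hg
  have hli := hE.linearIndependent_of_hasLead (f := fun x => f * E x) (e := fun x => e + x)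
    (w := w) (add_right_injective e) fun x => hE.hasLead_mul hf (hasLead_self x)
  have : c = 0 := by
    rw [linearIndependent_iff] at hli
    apply hli
    rw [Finsupp.linearCombination_apply, ← h, Finsupp.mul_sum]
    simp
  simp [this]

theorem eq_zero_of_mul_eq_zero_right [IsCancelAdd Γ] (hE : IsTorusBasis q ω E ev)
    (hf : HasLead k E w f e) (hg : g ∈ Submodule.span k (Set.range E)) (h : g * f = 0) : g = 0 := by
  obtain ⟨c, rfl⟩ := Finsupp.mem_span_range_iff_exists_finsupp.mp hg
  have hli := hE.linearIndependent_of_hasLead (f := fun x => E x * f) (e := fun x => x + e)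
    (w := w) (add_left_injective e) fun x => hE.hasLead_mul (hasLead_self x) hf
  have : c = 0 := by
    rw [linearIndependent_iff] at hli
    apply hli
    rw [Finsupp.linearCombination_apply, ← h, Finsupp.sum_mul]
    simp
  simp [this]

end IsTorusBasis

/-- The basis monomials of a twisted monoid algebra, as operators on `Γ →₀ k`. -/
noncomputable def torusOp (q : k) (ω : Γ →+ Γ →+ ℤ) (e : Γ) : Module.End k (Γ →₀ k) :=
  Finsupp.linearCombination k fun x => Finsupp.single (x + e) (q ^ ω e x)

theorem torusOp_single (q : k) (ω : Γ →+ Γ →+ ℤ) (e x : Γ) (c : k) :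
    torusOp q ω e (Finsupp.single x c) = Finsupp.single (x + e) (c * q ^ ω e x) := by
  simp [torusOp]

theorem isTorusBasis_torusOp {q : k} (hq : q ≠ 0) (ω : Γ →+ Γ →+ ℤ) :
    IsTorusBasis q ω (torusOp q ω) (LinearMap.applyₗ (Finsupp.single 0 1)) where
  ne_zero := hq
  zero := by
    refine Finsupp.lhom_ext fun x c => ?_
    simp [torusOp_single]
  mul e e' := by
    refine Finsupp.lhom_ext fun x c => ?_
    rw [Module.End.mul_apply, LinearMap.smul_apply, torusOp_single, torusOp_single, torusOp_single,
      Finsupp.smul_single, add_right_comm, add_assoc, map_add, map_add, AddMonoidHom.add_apply,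
      zpow_add₀ hq, zpow_add₀ hq, smul_eq_mul]
    congr 1
    ring
  ev_apply e := by
    rw [LinearMap.applyₗ_apply_apply, torusOp_single]
    simp

end Torus

section Weights

/-- The weight of an entry at distance `d` below the diagonal. -/
def distWeight (P d : ℕ) : ℕ := ∑ m ∈ Finset.range d, (P - m)

theorem distWeight_succ (P d : ℕ) : distWeight P (d + 1) = distWeight P d + (P - d) :=
  Finset.sum_range_succ _ _

theorem two_mul_distWeight {P d : ℕ} (h : d ≤ P) :
    2 * (distWeight P d : ℤ) = (2 * P + 1) * d - (d : ℤ) ^ 2 := by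
  induction d with
  | zero => simp [distWeight]
  | succ d ih =>
    rw [distWeight_succ, Nat.cast_add, mul_add, ih (by omega), Nat.cast_sub (by omega)]
    push_cast
    ring

theorem sum_distWeight_lt {P t : ℕ} {i : Fin t → ℕ} (hi : StrictMono i) (hiP : ∀ a, i a ≤ P)
    {c : Fin t → ℕ} (hc : Function.Injective c) (hci : ∀ a b, c a ≤ i b)
    (hne : c ≠ fun a : Fin t => (a : ℕ)) :
    ∑ a, distWeight P (i a - c a) < ∑ a : Fin t, distWeight P (i a - a) := by
  set τ := Tuple.sort c
  have hmono : StrictMono (c ∘ τ) :=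
    (Tuple.monotone_sort c).strictMono_of_injective (hc.comp τ.injective)
  have hle : ∀ a : Fin t, (a : ℕ) ≤ c (τ a) := by
    intro a
    obtain ⟨a, ha⟩ := a
    induction a with
    | zero => exact Nat.zero_le _
    | succ a ih =>
      have h1 := ih (by omega)
      have h2 := hmono (show (⟨a, by omega⟩ : Fin t) < ⟨a + 1, ha⟩ by simp [Fin.lt_def])
      simp only [Function.comp_apply] at h1 h2 ⊢
      omega
  have key : ∀ x : Fin t → ℕ, (∀ a, x a ≤ i a) →
      2 * ((∑ a, distWeight P (i a - x a) : ℕ) : ℤ) =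
        ∑ a, ((2 * P + 1) * (i a : ℤ) - (i a : ℤ) ^ 2) + 2 * ∑ a, (i a : ℤ) * x a -
          ∑ a, ((2 * P + 1) * (x a : ℤ) + (x a : ℤ) ^ 2) := by
    intro x hx
    rw [Nat.cast_sum, Finset.mul_sum, Finset.mul_sum, ← Finset.sum_add_distrib,
      ← Finset.sum_sub_distrib]
    refine Finset.sum_congr rfl fun a _ => ?_
    rw [two_mul_distWeight (by have := hiP a; omega), Nat.cast_sub (hx a)]
    ring
  have hterm : ∀ x y z : ℕ, x ≤ y → y ≤ z → distWeight P (z - y) ≤ distWeight P (z - x) := by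
    intro x y z hxy hyz
    exact Finset.sum_le_sum_of_subset (Finset.range_mono (by omega))
  have h2 : ∑ a, distWeight P (i a - c (τ a)) ≤ ∑ a : Fin t, distWeight P (i a - a) :=
    Finset.sum_le_sum fun a _ => hterm _ _ _ (hle a) (hci _ _)
  have hperm : ∑ a, ((2 * P + 1) * (c (τ a) : ℤ) + (c (τ a) : ℤ) ^ 2) =
      ∑ a, ((2 * P + 1) * (c a : ℤ) + (c a : ℤ) ^ 2) :=
    Equiv.sum_comp τ fun a => (2 * P + 1) * (c a : ℤ) + (c a : ℤ) ^ 2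
  have hmv : Monovary (fun a => (i a : ℤ)) (fun a => (c (τ a) : ℤ)) := by
    intro a b hab
    have : a < b := hmono.lt_iff_lt.mp (Nat.cast_lt.mp hab)
    exact Nat.cast_le.mpr (hi this).le
  have k1 := key c fun a => hci a a
  have k2 := key (c ∘ τ) fun a => hci _ a
  simp only [Function.comp_apply] at k2
  rw [hperm] at k2
  have hcomp : ((fun a => (c (τ a) : ℤ)) ∘ ⇑τ.symm) = fun a => (c a : ℤ) := by
    funext a; simp
  by_cases hm : Monovary (fun a => (i a : ℤ)) (fun a => (c a : ℤ))
  · have hcm : StrictMono c := by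
      intro a b hab
      rcases lt_trichotomy (c a) (c b) with h | h | h
      · exact h
      · exact absurd (hc h) hab.ne
      · have := hm (show (c b : ℤ) < c a by exact_mod_cast h)
        simp only [Nat.cast_le] at this
        exact absurd (hi hab) (not_lt.mpr this)
    have hle' : ∀ a : Fin t, (a : ℕ) ≤ c a := by
      have : c ∘ τ = c := by
        have : τ = 1 := Tuple.sort_eq_refl_iff_monotone.mpr hcm.monotone
        rw [this]; rfl
      intro a
      have h := hle a
      rwa [← Function.comp_apply (f := c), this] at h
    obtain ⟨a, ha⟩ := Function.ne_iff.mp hne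
    refine Finset.sum_lt_sum (fun a _ => hterm _ _ _ (hle' a) (hci _ _)) ⟨a, Finset.mem_univ _, ?_⟩
    have h3 := hle' a
    have h4 := hci a a
    have h5 := hiP a
    obtain ⟨d, hd⟩ : ∃ d, i a - a = d + 1 := ⟨i a - a - 1, by omega⟩
    rw [hd, distWeight_succ]
    have := hterm 0 (d - (i a - c a)) d (by omega) (by omega)
    rw [Nat.sub_zero, show d - (d - (i a - c a)) = i a - c a by omega] at this
    omega
  · have := (hmv.sum_mul_comp_perm_lt_sum_mul_iff (σ := τ.symm)).mpr (by rwa [hcomp])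
    have h3 : ∀ a, (c (τ (τ.symm a)) : ℤ) = c a := fun a => by simp
    simp only [h3] at this
    omega

end Weights

section Ladder

/-- Indices of the elementary variables: side, kind (diagonal or subdiagonal), step, position. -/
abbrev VarIdx : Type := Bool × Bool × ℕ × ℕ

/-- The exponent vector of a single variable. -/
noncomputable def varExp (s t : Bool) (m l : ℕ) : VarIdx →₀ ℕ := Finsupp.single (s, t, m, l) 1

/-- The commutation exponents of the elementary variables. -/
def varForm (x y : VarIdx) : ℤ :=
  if x.1 = y.1 ∧ x.2.2.1 = y.2.2.1 ∧ x.2.1 ≠ y.2.1 ∧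
    y.2.2.2 = x.2.2.2 + (if x.2.1 then 1 else 0) then 1 else 0

/-- The bilinear extension of `varForm` to exponent vectors. -/
noncomputable def expForm : (VarIdx →₀ ℕ) →+ (VarIdx →₀ ℕ) →+ ℤ :=
  Finsupp.liftAddHom fun x => multiplesHom _
    (Finsupp.liftAddHom fun y => multiplesHom _ (varForm x y))

/-- The weight of an exponent vector. -/
noncomputable def expWeight (P : ℕ) : (VarIdx →₀ ℕ) →+ ℕ :=
  Finsupp.liftAddHom fun x => multiplesHom _ (if x.2.1 then P - x.2.2.1 else 0)

theorem expForm_varExp (s t : Bool) (m l : ℕ) (s' t' : Bool) (m' l' : ℕ) :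
    expForm (varExp s t m l) (varExp s' t' m' l') = varForm (s, t, m, l) (s', t', m', l') := by
  simp [expForm, varExp]

theorem expWeight_varExp (P : ℕ) (s t : Bool) (m l : ℕ) :
    expWeight P (varExp s t m l) = if t then P - m else 0 := by
  simp [expWeight, varExp]

variable {k A : Type*} [Field k] [Ring A] [Algebra k A]

/-- The product of the first `m` bidiagonal matrices on the side `s`. -/
noncomputable def ladder (E : (VarIdx →₀ ℕ) → A) (s : Bool) : ℕ → ℕ → ℕ → A
  | 0, i, c => if i = c then 1 else 0
  | m + 1, i, c => ladder E s m i c * E (varExp s false m c) +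
      ladder E s m i (c + 1) * E (varExp s true m c)

/-- The leading exponents of the entries of `ladder`. -/
noncomputable def ladderExp (s : Bool) : ℕ → ℕ → ℕ → (VarIdx →₀ ℕ)
  | 0, _, _ => 0
  | m + 1, i, c => if i ≤ c + m then ladderExp s m i c + varExp s false m c
      else ladderExp s m i (c + 1) + varExp s true m c

variable {E : (VarIdx →₀ ℕ) → A}

theorem ladder_eq_zero_of_lt (s : Bool) (m : ℕ) {i c : ℕ} (h : i < c) : ladder E s m i c = 0 := by
  induction m generalizing c with
  | zero => simp [ladder, h.ne]
  | succ m ih => rw [ladder, ih h, ih (by omega), zero_mul, zero_mul, add_zero]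

theorem ladder_eq_zero_of_gt (s : Bool) (m : ℕ) {i c : ℕ} (h : c + m < i) :
    ladder E s m i c = 0 := by
  induction m generalizing c with
  | zero => rw [ladder, if_neg (by omega)]
  | succ m ih => rw [ladder, ih (by omega), ih (by omega), zero_mul, zero_mul, add_zero]

theorem expWeight_ladderExp (P : ℕ) (s : Bool) (m : ℕ) {i c : ℕ} (h : c ≤ i) (h' : i ≤ c + m) :
    expWeight P (ladderExp s m i c) = distWeight P (i - c) := by
  induction m generalizing c with
  | zero => simp [ladderExp, distWeight, show i - c = 0 by omega]
  | succ m ih =>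
    rw [ladderExp]
    split_ifs with hm
    · rw [map_add, expWeight_varExp, ih h hm]
      simp
    · rw [map_add, expWeight_varExp, ih (by omega) (by omega), show i - c = m + 1 by omega,
        distWeight_succ, show i - (c + 1) = m by omega]
      simp

theorem ladderExp_apply (s : Bool) (M : ℕ) {i c : ℕ} (h : c ≤ i) (h' : i ≤ c + M) (s' : Bool)
    (m l : ℕ) : ladderExp s M i c (s', true, m, l) =
      if s' = s ∧ i = l + m + 1 ∧ c ≤ l then 1 else 0 := by
  induction M generalizing c with
  | zero =>
    rw [ladderExp, Finsupp.zero_apply, if_neg]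
    omega
  | succ M ih =>
    rw [ladderExp]
    split_ifs with hm hc hc
    · rw [Finsupp.add_apply, ih h hm, if_pos hc]
      simp [varExp]
    · rw [Finsupp.add_apply, ih h hm, if_neg hc]
      simp [varExp]
    · rw [Finsupp.add_apply, ih (by omega) (by omega), varExp, Finsupp.single_apply]
      simp only [Prod.mk.injEq, true_and]
      obtain ⟨rfl, h1, h2⟩ := hc
      split_ifs <;> first | rfl | (exfalso; simp at *; omega)
    · rw [Finsupp.add_apply, ih (by omega) (by omega), varExp, Finsupp.single_apply]
      simp only [Prod.mk.injEq, true_and]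
      split_ifs with h1 h2 h2 <;> first | rfl | (exfalso; apply hc; simp at *; grind)

theorem commute_ladder {x : A} {s : Bool} (m : ℕ)
    (h : ∀ t, ∀ m' < m, ∀ l, Commute x (E (varExp s t m' l))) (i c : ℕ) :
    Commute x (ladder E s m i c) := by
  induction m generalizing c with
  | zero =>
    rw [ladder]
    split_ifs
    · exact Commute.one_right x
    · exact Commute.zero_right x
  | succ m ih =>
    have ih' := ih fun t m' hm' l => h t m' (by omega) l
    exact ((ih' c).mul_right (h _ _ (by omega) _)).add_right
      ((ih' (c + 1)).mul_right (h _ _ (by omega) _))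

variable {q : k} {ev : A →ₗ[k] (VarIdx →₀ ℕ) →₀ k}

theorem IsTorusBasis.commute_of_varForm (hE : IsTorusBasis q expForm E ev) {s t s' t' : Bool}
    {m l m' l' : ℕ}
    (h : varForm (s, t, m, l) (s', t', m', l') = varForm (s', t', m', l') (s, t, m, l)) :
    Commute (E (varExp s t m l)) (E (varExp s' t' m' l')) := by
  rw [Commute, SemiconjBy, hE.mul_comm, expForm_varExp, expForm_varExp, h, sub_self, zpow_zero,
    one_smul]

theorem IsTorusBasis.hasLead_ladder (hE : IsTorusBasis q expForm E ev) {P : ℕ} (s : Bool) (m : ℕ)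
    (hm : m ≤ P) {i c : ℕ} (h : c ≤ i) (h' : i ≤ c + m) :
    HasLead k E (expWeight P) (ladder E s m i c) (ladderExp s m i c) := by
  induction m generalizing c with
  | zero =>
    rw [ladder, ladderExp, if_pos (by omega)]
    exact hE.hasLead_one
  | succ m ih =>
    rw [ladder, ladderExp]
    split_ifs with hi
    · refine (hE.hasLead_mul (ih (by omega) h hi) (hasLead_self _)).add ?_
      rcases h.eq_or_lt with rfl | hlt
      · rw [ladder_eq_zero_of_lt _ _ (Nat.lt_succ_self _), zero_mul]
        exact zero_mem _
      · refine (hE.hasLead_mul (ih (by omega) (c := c + 1) (by omega) (by omega))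
          (hasLead_self _)).mem_lowSpan ?_
        rw [map_add, map_add, expWeight_varExp, expWeight_varExp,
          expWeight_ladderExp P s m h hi, expWeight_ladderExp P s m (by omega) (by omega),
          show i - c = (i - (c + 1)) + 1 by omega, distWeight_succ]
        simp
        omega
    · rw [ladder_eq_zero_of_gt _ _ (by omega), zero_mul, zero_add]
      exact hE.hasLead_mul (ih (by omega) (by omega) (by omega)) (hasLead_self _)

theorem IsTorusBasis.isQMatrix_bidiagonal (hE : IsTorusBasis q expForm E ev) (s : Bool) (m : ℕ) :
    IsQMatrix q (fun i j : ℕ => if i = j then E (varExp s false m j)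
      else if i = j + 1 then E (varExp s true m j) else 0) := by
  apply QuantumDet.isQMatrix_bidiagonal
  · exact fun i j => hE.commute_of_varForm (by simp [varForm])
  · exact fun i j => hE.commute_of_varForm (by simp [varForm])
  · intro i
    rw [hE.mul_comm, expForm_varExp, expForm_varExp]
    simp [varForm]
  · intro i
    rw [hE.mul_comm, expForm_varExp, expForm_varExp]
    simp [varForm]
  · intro i j h1 h2
    refine hE.commute_of_varForm ?_
    simp [varForm, h1.symm, h2]

theorem IsTorusBasis.isQMatrix_ladder [CharZero k] (hE : IsTorusBasis q expForm E ev) (s : Bool)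
    (m : ℕ) : IsQMatrix q (ladder E s m) := by
  induction m with
  | zero => exact isQMatrix_ite_eq q
  | succ m ih =>
    have hN := fun N => ih.mul hE.ne_zero (hE.isQMatrix_bidiagonal s m) (fun i c d j => by
      have h : ∀ t l, Commute (E (varExp s t m l)) (ladder E s m i c) := fun t l =>
        commute_ladder m (fun t' m' hm' l' => hE.commute_of_varForm
          (by simp [varForm, hm'.ne, hm'.ne'])) i c
      split_ifs
      · exact (h _ _).symm
      · exact (h _ _).symm
      · rw [mul_zero, zero_mul]) (Finset.range N)
    have hs : ∀ N i j, j + 1 < N → ∑ c ∈ Finset.range N, ladder E s m i c *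
        (if c = j then E (varExp s false m j)
          else if c = j + 1 then E (varExp s true m j) else 0) = ladder E s (m + 1) i j := by
      intro N i j hj
      rw [ladder, ← Finset.sum_subset (s₁ := {j, j + 1})]
      · rw [Finset.sum_pair (by omega)]
        simp
      · intro x hx
        simp only [Finset.mem_insert, Finset.mem_singleton] at hx
        rw [Finset.mem_range]
        omega
      · intro x _ hx
        simp only [Finset.mem_insert, Finset.mem_singleton, not_or] at hx
        simp [hx.1, hx.2]
    refine ⟨fun i j l h => ?_, fun i s j h => ?_, fun i s j l h h' => ?_, fun i s j l h h' => ?_⟩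
    · have := (hN (j + l + 2)).row i j l h
      rwa [hs _ _ _ (by omega), hs _ _ _ (by omega)] at this
    · have := (hN (j + 2)).col i s j h
      rwa [hs _ _ _ (by omega), hs _ _ _ (by omega)] at this
    · have := (hN (j + l + 2)).cross i s j l h h'
      rwa [hs _ _ _ (by omega), hs _ _ _ (by omega)] at this
    · have := (hN (j + l + 2)).diag i s j l h h'
      rwa [hs _ _ _ (by omega), hs _ _ _ (by omega), hs _ _ _ (by omega),
        hs _ _ _ (by omega)] at this

theorem IsTorusBasis.ladder_mul_comm (hE : IsTorusBasis q expForm E ev) {s s' : Bool} (hs : s ≠ s')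
    (m m' i c i' c' : ℕ) : ladder E s m i c * ladder E s' m' i' c' =
      ladder E s' m' i' c' * ladder E s m i c := by
  refine commute_ladder m' (fun t' m₂ _ l' => ?_) i' c'
  refine (commute_ladder m (fun t m₁ _ l => ?_) i c).symm
  exact hE.commute_of_varForm (by simp [varForm, hs, hs.symm])

theorem IsTorusBasis.ladder_mem_span (hE : IsTorusBasis q expForm E ev) (s : Bool) (m i c : ℕ) :
    ladder E s m i c ∈ Submodule.span k (Set.range E) := by
  rcases lt_or_ge i c with h | h
  · rw [ladder_eq_zero_of_lt s m h]
    exact zero_mem _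
  rcases lt_or_ge (c + m) i with h' | h'
  · rw [ladder_eq_zero_of_gt s m h']
    exact zero_mem _
  · exact lowSpan_le_span _ ((hE.hasLead_ladder (P := m) s m le_rfl h h').mem_lowSpan
      (Nat.lt_succ_self _))

end Ladder

section RankMatrix

variable {k A : Type*} [Field k] [Ring A] [Algebra k A]

/-- A quantum matrix of rank `r`, written as a product of two ladders. -/
noncomputable def rankMatrix (E : (VarIdx →₀ ℕ) → A) (n r : ℕ) (i j : Fin n) : A :=
  ∑ c ∈ Finset.range r,
    ladder E false (2 * n) (i + n) c * ladder E true (2 * n) (j + n) c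

/-- The leading exponent of a minor of `rankMatrix`. -/
noncomputable def minorExp {n t : ℕ} (row col : Fin t → Fin n) : VarIdx →₀ ℕ :=
  ∑ a : Fin t, (ladderExp false (2 * n) (row a + n) a + ladderExp true (2 * n) (col a + n) a)

variable {E : (VarIdx →₀ ℕ) → A} {q : k} {ev : A →ₗ[k] (VarIdx →₀ ℕ) →₀ k} {n r : ℕ}

namespace IsTorusBasis

theorem isQMatrix_ladder_row [CharZero k] (hE : IsTorusBasis q expForm E ev) (n : ℕ) :
    IsQMatrix q fun (i : Fin n) (c : ℕ) => ladder E false (2 * n) (i + n) c :=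
  (hE.isQMatrix_ladder false (2 * n)).submatrix (f := fun i : Fin n => (i : ℕ) + n) (g := id)
    (fun i j h => by simpa using h) strictMono_id

theorem isQMatrix_ladder_col [CharZero k] (hE : IsTorusBasis q expForm E ev) (n : ℕ) :
    IsQMatrix q fun (c : ℕ) (j : Fin n) => ladder E true (2 * n) (j + n) c :=
  ((hE.isQMatrix_ladder true (2 * n)).submatrix (f := fun i : Fin n => (i : ℕ) + n) (g := id)
    (fun i j h => by simpa using h) strictMono_id).transpose

theorem isQMatrix_rankMatrix [CharZero k] (hE : IsTorusBasis q expForm E ev) (n r : ℕ) :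
    IsQMatrix q (rankMatrix E n r) :=
  (hE.isQMatrix_ladder_row n).mul hE.ne_zero (hE.isQMatrix_ladder_col n)
    (fun i c d j => hE.ladder_mul_comm (by simp) _ _ _ _ _ _) (Finset.range r)

theorem qdet_rankMatrix_eq_zero [CharZero k] (hE : IsTorusBasis q expForm E ev) {t : ℕ}
    (ht : r < t) (row : Fin t → Fin n) {col : Fin t → Fin n} (hcol : StrictMono col) :
    qdet q (rankMatrix E n r) row col = 0 :=
  (hE.isQMatrix_ladder_col n).qdet_mul_eq_zero hE.ne_zero
    (fun i c d j => hE.ladder_mul_comm (by simp) _ _ _ _ _ _) ht row hcol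

theorem rankMatrix_mem_span (hE : IsTorusBasis q expForm E ev) (n r : ℕ) (i j : Fin n) :
    rankMatrix E n r i j ∈ Submodule.span k (Set.range E) :=
  Submodule.sum_mem _ fun _ _ => hE.mul_mem_span (hE.ladder_mem_span _ _ _ _)
    (hE.ladder_mem_span _ _ _ _)

theorem hasLead_qdet_rankMatrix [CharZero k] (hE : IsTorusBasis q expForm E ev) (hrn : r ≤ n)
    {t : ℕ} (ht : t ≤ r) {row col : Fin t → Fin n} (hrow : StrictMono row)
    (hcol : StrictMono col) :
    HasLead k E (expWeight (2 * n)) (qdet q (rankMatrix E n r) row col) (minorExp row col) := by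
  classical
  have hexp := (hE.isQMatrix_ladder_col n).qdet_mul_eq_sum_injective hE.ne_zero (r := r)
    (X := fun (i : Fin n) (c : ℕ) => ladder E false (2 * n) (i + n) c)
    (fun i c d j => hE.ladder_mul_comm (by simp) _ _ _ _ _ _) row hcol
  have hlead : ∀ (c : Fin t ↪ Fin r) (σ : Equiv.Perm (Fin t)),
      HasLead k E (expWeight (2 * n)) (((-q) ^ invCount σ) • (List.ofFn fun a =>
        ladder E false (2 * n) (row a + n) (c a) *
          ladder E true (2 * n) (col (σ a) + n) (c a)).prod)
        (∑ a : Fin t, (ladderExp false (2 * n) (row a + n) (c a) +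
          ladderExp true (2 * n) (col (σ a) + n) (c a))) := by
    intro c σ
    refine (hE.hasLead_prod_ofFn fun a => hE.hasLead_mul (hE.hasLead_ladder _ _ le_rfl ?_ ?_)
      (hE.hasLead_ladder _ _ le_rfl ?_ ?_)).smul (pow_ne_zero _ (neg_ne_zero.mpr hE.ne_zero)) <;>
    omega
  have hweight : ∀ (c : Fin t ↪ Fin r) (σ : Equiv.Perm (Fin t)),
      expWeight (2 * n) (∑ a : Fin t, (ladderExp false (2 * n) (row a + n) (c a) +
          ladderExp true (2 * n) (col (σ a) + n) (c a))) =
        ∑ a, distWeight (2 * n) (row a + n - c a) +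
          ∑ a, distWeight (2 * n) (col a + n - c (σ.symm a)) := by
    intro c σ
    rw [map_sum, ← Equiv.sum_comp σ fun a => distWeight (2 * n) (col a + n - c (σ.symm a)),
      ← Finset.sum_add_distrib]
    refine Finset.sum_congr rfl fun a _ => ?_
    rw [map_add, expWeight_ladderExp, expWeight_ladderExp, Equiv.symm_apply_apply] <;> omega
  have hmax : ∀ I : Fin t → Fin n, StrictMono I → ∀ c : Fin t → Fin r, Function.Injective c →
      (fun a => (c a : ℕ)) ≠ (fun a : Fin t => (a : ℕ)) →
      ∑ a, distWeight (2 * n) (I a + n - c a) < ∑ a, distWeight (2 * n) (I a + n - a) := by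
    intro I hI c hc hne
    refine sum_distWeight_lt (i := fun a => (I a : ℕ) + n) (fun a b hab => ?_) (fun a => ?_)
      (c := fun a => (c a : ℕ)) (fun a b hab => hc (Fin.ext hab)) (fun a b => ?_) hne
    · simpa using hI hab
    · have := (I a).2; omega
    · have := (c a).2
      change (c a : ℕ) ≤ I b + n
      omega
  set c₀ : Fin t ↪ Fin r := Fin.castLEEmb ht with hc₀
  have hval : ∀ a, (c₀ a : ℕ) = a := fun a => rfl
  have hbase : minorExp row col = ∑ a : Fin t, (ladderExp false (2 * n) (row a + n) (c₀ a) +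
          ladderExp true (2 * n) (col ((1 : Equiv.Perm (Fin t)) a) + n) (c₀ a)) := by
    simp [minorExp, hval]
  have hsum : qdet q (rankMatrix E n r) row col = ∑ p : (Fin t ↪ Fin r) × Equiv.Perm (Fin t),
      ((-q) ^ invCount p.2) • (List.ofFn fun a =>
        ladder E false (2 * n) (row a + n) (p.1 a) *
          ladder E true (2 * n) (col (p.2 a) + n) (p.1 a)).prod := by
    rw [Fintype.sum_prod_type]
    exact hexp
  rw [hsum, ← Finset.add_sum_erase _ _ (Finset.mem_univ (c₀, 1)), hbase]
  refine (hlead c₀ 1).add (Submodule.sum_mem _ ?_)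
  rintro ⟨c, σ⟩ hp
  refine (hlead c σ).mem_lowSpan ?_
  rw [hweight, hweight]
  simp only [hval]
  have h1 : (fun a => (c a : ℕ)) ≠ (fun a : Fin t => (a : ℕ)) ∨
      (fun a => (c (σ.symm a) : ℕ)) ≠ (fun a : Fin t => (a : ℕ)) := by
    by_contra! hcon
    obtain ⟨hc1, hc2⟩ := hcon
    apply (Finset.mem_erase.mp hp).1
    have hc : c = c₀ := by
      ext a
      exact congrFun hc1 a
    rw [Prod.mk.injEq]
    refine ⟨hc, ?_⟩
    ext a
    have := congrFun hc2 (σ a)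
    simp only [Equiv.symm_apply_apply] at this
    rw [← this, hc]
    rfl
  have hle : ∀ I : Fin t → Fin n, StrictMono I → ∀ c : Fin t → Fin r, Function.Injective c →
      ∑ a, distWeight (2 * n) (I a + n - c a) ≤ ∑ a, distWeight (2 * n) (I a + n - a) := by
    intro I hI c hc
    by_cases hne : (fun a => (c a : ℕ)) = (fun a : Fin t => (a : ℕ))
    · exact le_of_eq (Finset.sum_congr rfl fun a _ => by rw [congrFun hne a])
    · exact (hmax I hI c hc hne).le
  rcases h1 with h1 | h1
  · exact add_lt_add_of_lt_of_le (hmax row hrow c c.injective h1)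
      (hle col hcol _ (c.injective.comp σ.symm.injective))
  · exact add_lt_add_of_le_of_lt (hle row hrow c c.injective)
      (hmax col hcol _ (c.injective.comp σ.symm.injective) h1)

end IsTorusBasis

theorem minorExp_apply_false {t : ℕ} (htn : t ≤ n) (row col : Fin t → Fin n) (m l : ℕ) :
    minorExp row col (false, true, m, l) =
      ∑ a : Fin t, if (row a : ℕ) + n = l + m + 1 ∧ (a : ℕ) ≤ l then 1 else 0 := by
  rw [minorExp, Finsupp.finsetSum_apply]
  refine Finset.sum_congr rfl fun a _ => ?_
  rw [Finsupp.add_apply, ladderExp_apply _ _ (by omega) (by omega),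
    ladderExp_apply _ _ (by omega) (by omega)]
  simp

theorem minorExp_apply_true {t : ℕ} (htn : t ≤ n) (row col : Fin t → Fin n) (m l : ℕ) :
    minorExp row col (true, true, m, l) =
      ∑ a : Fin t, if (col a : ℕ) + n = l + m + 1 ∧ (a : ℕ) ≤ l then 1 else 0 := by
  rw [minorExp, Finsupp.finsetSum_apply]
  refine Finset.sum_congr rfl fun a _ => ?_
  rw [Finsupp.add_apply, ladderExp_apply _ _ (by omega) (by omega),
    ladderExp_apply _ _ (by omega) (by omega)]
  simp

end RankMatrix

section Straightening

variable {k A : Type*} [Field k] [Ring A] [Algebra k A] {n : ℕ}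

/-- The product of the entries of `z` along a word. -/
def wordProd (z : Fin n → Fin n → A) (l : List (Fin n × Fin n)) : A :=
  (l.map fun p => z p.1 p.2).prod

/-- The weight of a word. -/
def wordWeight (l : List (Fin n × Fin n)) : ℕ := (l.map fun p => (p.1 * p.2 : ℕ)).sum

variable (k) in
/-- The span of the products along words of length `D` and weight less than `v`. -/
def lowWordSpan (z : Fin n → Fin n → A) (D v : ℕ) : Submodule k A :=
  Submodule.span k (wordProd z '' {l | l.length = D ∧ wordWeight l < v})

/-- The multiset `m` contains a strictly increasing chain of length `t`. -/
def HasChain (t : ℕ) (m : Multiset (Fin n × Fin n)) : Prop :=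
  ∃ ro co : Fin t → Fin n, StrictMono ro ∧ StrictMono co ∧ ∀ a, (ro a, co a) ∈ m

variable {z : Fin n → Fin n → A}

theorem wordProd_append (l l' : List (Fin n × Fin n)) :
    wordProd z (l ++ l') = wordProd z l * wordProd z l' := by
  simp [wordProd]

theorem wordWeight_append (l l' : List (Fin n × Fin n)) :
    wordWeight (l ++ l') = wordWeight l + wordWeight l' := by
  simp [wordWeight]

theorem _root_.List.Perm.wordWeight_eq {l l' : List (Fin n × Fin n)} (h : l.Perm l') :
    wordWeight l = wordWeight l' :=
  (h.map _).sum_eq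

theorem wordProd_mem_lowWordSpan {l : List (Fin n × Fin n)} {D v : ℕ} (hD : l.length = D)
    (hv : wordWeight l < v) : wordProd z l ∈ lowWordSpan k z D v :=
  Submodule.subset_span ⟨l, ⟨hD, hv⟩, rfl⟩

theorem wordProd_mul_mem_lowWordSpan (l : List (Fin n × Fin n)) {D v : ℕ} {f : A}
    (hf : f ∈ lowWordSpan k z D v) :
    wordProd z l * f ∈ lowWordSpan k z (l.length + D) (wordWeight l + v) := by
  induction hf using Submodule.span_induction with
  | mem x hx =>
    obtain ⟨l', ⟨h1, h2⟩, rfl⟩ := hx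
    rw [← wordProd_append]
    exact wordProd_mem_lowWordSpan (by simp [h1]) (by rw [wordWeight_append]; omega)
  | zero => rw [mul_zero]; exact zero_mem _
  | add x y _ _ hx hy => rw [mul_add]; exact add_mem hx hy
  | smul a x _ hx => rw [mul_smul_comm]; exact Submodule.smul_mem _ _ hx

theorem mul_wordProd_mem_lowWordSpan (l : List (Fin n × Fin n)) {D v : ℕ} {f : A}
    (hf : f ∈ lowWordSpan k z D v) :
    f * wordProd z l ∈ lowWordSpan k z (D + l.length) (v + wordWeight l) := by
  induction hf using Submodule.span_induction with
  | mem x hx =>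
    obtain ⟨l', ⟨h1, h2⟩, rfl⟩ := hx
    rw [← wordProd_append]
    exact wordProd_mem_lowWordSpan (by simp [h1]) (by rw [wordWeight_append]; omega)
  | zero => rw [zero_mul]; exact zero_mem _
  | add x y _ _ hx hy => rw [add_mul]; exact add_mem hx hy
  | smul a x _ hx => rw [smul_mul_assoc]; exact Submodule.smul_mem _ _ hx

theorem mul_lt_of_lt_of_lt {i s j t : ℕ} (h : i < s) (h' : j < t) :
    i * t + s * j < i * j + s * t := by
  obtain ⟨a, rfl⟩ := Nat.exists_eq_add_of_lt h
  obtain ⟨b, rfl⟩ := Nat.exists_eq_add_of_lt h'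
  nlinarith [Nat.zero_le (a * b)]

namespace IsQMatrix

variable {q : k}

theorem exists_mul_sub_smul_mem (hq : q ≠ 0) (hz : IsQMatrix q z) (x y : Fin n × Fin n) :
    ∃ c : k, c ≠ 0 ∧ z x.1 x.2 * z y.1 y.2 - c • (z y.1 y.2 * z x.1 x.2) ∈
      lowWordSpan k z 2 (x.1 * x.2 + y.1 * y.2) := by
  obtain ⟨i, j⟩ := x
  obtain ⟨s, t⟩ := y
  have hlow : ∀ i s j t : Fin n, i < s → j < t →
      z i t * z s j ∈ lowWordSpan k z 2 (i * j + s * t) := by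
    intro i s j t h h'
    have : z i t * z s j = wordProd z [(i, t), (s, j)] := by simp [wordProd]
    rw [this]
    exact wordProd_mem_lowWordSpan rfl (by
      simpa [wordWeight] using mul_lt_of_lt_of_lt (Fin.lt_def.mp h) (Fin.lt_def.mp h'))
  have key : ∀ c : k, c ≠ 0 → z i j * z s t = c • (z s t * z i j) → ∃ c : k, c ≠ 0 ∧
      z i j * z s t - c • (z s t * z i j) ∈ lowWordSpan k z 2 (i * j + s * t) := by
    intro c hc h
    exact ⟨c, hc, by rw [h, sub_self]; exact zero_mem _⟩
  rcases lt_trichotomy i s with his | rfl | his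
  · rcases lt_trichotomy j t with hjt | rfl | hjt
    · refine ⟨1, one_ne_zero, ?_⟩
      rw [one_smul, hz.diag i s j t his hjt, add_sub_cancel_left]
      exact Submodule.smul_mem _ _ (hlow i s j t his hjt)
    · exact key q hq (hz.col i s j his)
    · exact key 1 one_ne_zero (by rw [one_smul, hz.cross i s j t his hjt])
  · rcases lt_trichotomy j t with hjt | rfl | hjt
    · exact key q hq (hz.row i j t hjt)
    · exact key 1 one_ne_zero (by rw [one_smul])
    · exact key q⁻¹ (inv_ne_zero hq) (by rw [hz.row i t j hjt, smul_smul, inv_mul_cancel₀ hq,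
        one_smul])
  · rcases lt_trichotomy j t with hjt | rfl | hjt
    · exact key 1 one_ne_zero (by rw [one_smul, hz.cross s i t j his hjt])
    · exact key q⁻¹ (inv_ne_zero hq) (by rw [hz.col s i j his, smul_smul, inv_mul_cancel₀ hq,
        one_smul])
    · refine ⟨1, one_ne_zero, ?_⟩
      rw [one_smul, hz.diag s i t j his hjt, sub_add_cancel_left, add_comm]
      exact neg_mem (Submodule.smul_mem _ _ (hlow s i t j his hjt))

theorem exists_wordProd_sub_smul_mem (hq : q ≠ 0) (hz : IsQMatrix q z)
    {l l' : List (Fin n × Fin n)} (h : l.Perm l') :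
    ∃ c : k, c ≠ 0 ∧ wordProd z l - c • wordProd z l' ∈
      lowWordSpan k z l.length (wordWeight l) := by
  induction h with
  | nil => exact ⟨1, one_ne_zero, by simp⟩
  | @cons x l l' _ ih =>
    obtain ⟨c, hc, h⟩ := ih
    refine ⟨c, hc, ?_⟩
    have := wordProd_mul_mem_lowWordSpan [x] h
    rw [mul_sub, mul_smul_comm, ← wordProd_append, ← wordProd_append, ← List.length_append,
      ← wordWeight_append] at this
    exact this
  | swap x y l =>
    obtain ⟨c, hc, h⟩ := hz.exists_mul_sub_smul_mem hq y x
    refine ⟨c, hc, ?_⟩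
    have := mul_wordProd_mem_lowWordSpan l h
    rw [sub_mul, smul_mul_assoc] at this
    have e1 : ∀ x y, wordProd z (x :: y :: l) = z x.1 x.2 * z y.1 y.2 * wordProd z l := by
      simp [wordProd, mul_assoc]
    have e2 : (y :: x :: l).length = 2 + l.length := by
      simp only [List.length_cons]
      omega
    have e3 : wordWeight (y :: x :: l) = y.1 * y.2 + x.1 * x.2 + wordWeight l := by
      simp [wordWeight, add_assoc]
    rw [e1, e1, e2, e3]
    exact this
  | @trans l₁ l₂ l₃ h₁ _ ih₁ ih₂ =>
    obtain ⟨c, hc, h⟩ := ih₁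
    obtain ⟨c', hc', h'⟩ := ih₂
    refine ⟨c * c', mul_ne_zero hc hc', ?_⟩
    rw [← h₁.length_eq, ← h₁.wordWeight_eq] at h'
    have := add_mem h (Submodule.smul_mem _ c h')
    rwa [smul_sub, smul_smul, sub_add_sub_cancel] at this

theorem wordProd_mem_of_qdet_eq_zero {t : ℕ} {ro co : Fin t → Fin n}
    (hro : StrictMono ro) (hco : StrictMono co) (h : qdet q z ro co = 0) :
    wordProd z (List.ofFn fun a => (ro a, co a)) ∈
      lowWordSpan k z t (wordWeight (List.ofFn fun a => (ro a, co a))) := by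
  have hprod : ∀ σ : Equiv.Perm (Fin t), (List.ofFn fun a => z (ro a) (co (σ a))).prod =
      wordProd z (List.ofFn fun a => (ro a, co (σ a))) := by
    intro σ
    rw [wordProd, List.map_ofFn]
    rfl
  have hweight : ∀ σ : Equiv.Perm (Fin t), wordWeight (List.ofFn fun a => (ro a, co (σ a))) =
      ∑ a, (ro a : ℕ) * (co (σ a) : ℕ) := by
    intro σ
    rw [wordWeight, List.map_ofFn, List.sum_ofFn]
    rfl
  rw [qdet, ← Finset.add_sum_erase _ _ (Finset.mem_univ 1), invCount_one, pow_zero, one_smul,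
    hprod] at h
  have h1 : wordProd z (List.ofFn fun a => (ro a, co a)) = - _ := eq_neg_of_add_eq_zero_left h
  rw [h1]
  refine neg_mem (Submodule.sum_mem _ fun σ hσ => Submodule.smul_mem _ _ ?_)
  rw [hprod]
  refine wordProd_mem_lowWordSpan (by simp) ?_
  have h2 := hweight 1
  simp only [Equiv.Perm.one_apply] at h2
  rw [hweight, h2]
  have hmv : Monovary (fun a => (ro a : ℕ)) (fun a => (co a : ℕ)) := by
    intro a b hab
    exact (hro (hco.lt_iff_lt.mp (Fin.lt_def.mpr hab))).le
  refine (hmv.sum_mul_comp_perm_lt_sum_mul_iff (σ := σ)).mpr fun hm => ?_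
  apply (Finset.mem_erase.mp hσ).1
  have hmono : StrictMono σ := by
    intro a b hab
    rcases lt_trichotomy (σ a) (σ b) with h | h | h
    · exact h
    · exact absurd (σ.injective h) hab.ne
    · exact absurd (hm (Fin.lt_def.mp (hco h))) (not_le.mpr (Fin.lt_def.mp (hro hab)))
  have := hmono.range_inj strictMono_id |>.mp (by simp [σ.surjective.range_eq])
  ext a
  simp [this]

theorem wordProd_mem_span_of_qdet_eq_zero (hq : q ≠ 0) (hz : IsQMatrix q z) {t : ℕ}
    (h : ∀ ro co : Fin t → Fin n, StrictMono ro → StrictMono co → qdet q z ro co = 0)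
    (l : List (Fin n × Fin n)) :
    wordProd z l ∈ Submodule.span k ((fun m : Multiset (Fin n × Fin n) => wordProd z m.toList) ''
      {m | Multiset.card m = l.length ∧ ¬ HasChain t m}) := by
  classical
  induction hN : wordWeight l using Nat.strong_induction_on generalizing l with
  | _ N ih =>
    subst hN
    have hlow : lowWordSpan k z l.length (wordWeight l) ≤ Submodule.span k
        ((fun m : Multiset (Fin n × Fin n) => wordProd z m.toList) ''
          {m | Multiset.card m = l.length ∧ ¬ HasChain t m}) := by
      rw [lowWordSpan, Submodule.span_le]
      rintro _ ⟨l', ⟨h1, h2⟩, rfl⟩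
      rw [← h1]
      exact ih _ h2 l' rfl
    by_cases hc : HasChain t (l : Multiset (Fin n × Fin n))
    · obtain ⟨ro, co, hro, hco, hmem⟩ := hc
      set C := List.ofFn fun a => (ro a, co a) with hC
      have hnd : C.Nodup := List.nodup_ofFn.mpr fun a b hab => hro.injective (Prod.mk.inj hab).1
      have hle : (C : Multiset (Fin n × Fin n)) ≤ l := by
        refine (Multiset.le_iff_subset (Multiset.coe_nodup.mpr hnd)).mpr fun x hx => ?_
        obtain ⟨a, rfl⟩ := (List.mem_ofFn' _ _).mp (Multiset.mem_coe.mp hx)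
        exact hmem a
      have hperm : l.Perm (C ++ (l - C : Multiset (Fin n × Fin n)).toList) := by
        rw [← Multiset.coe_eq_coe, ← Multiset.coe_add, Multiset.coe_toList,
          add_tsub_cancel_of_le hle]
      obtain ⟨c, -, h1⟩ := hz.exists_wordProd_sub_smul_mem hq hperm
      rw [← sub_add_cancel (wordProd z l) (c • wordProd z _)]
      refine add_mem (hlow h1) (Submodule.smul_mem _ _ (hlow ?_))
      have h2 := mul_wordProd_mem_lowWordSpan (l - C : Multiset (Fin n × Fin n)).toList
        (wordProd_mem_of_qdet_eq_zero hro hco (h ro co hro hco))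
      rw [← wordProd_append, ← wordWeight_append, ← hC, ← hperm.wordWeight_eq] at h2
      convert h2 using 2
      rw [hperm.length_eq, List.length_append, hC, List.length_ofFn]
    · have hperm : l.Perm (l : Multiset (Fin n × Fin n)).toList := by
        rw [← Multiset.coe_eq_coe, Multiset.coe_toList]
      obtain ⟨c, -, h1⟩ := hz.exists_wordProd_sub_smul_mem hq hperm
      rw [← sub_add_cancel (wordProd z l) (c • wordProd z _)]
      exact add_mem (hlow h1) (Submodule.smul_mem _ _ (Submodule.subset_span
        ⟨l, ⟨Multiset.coe_card l, hc⟩, rfl⟩))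

end IsQMatrix

end Straightening

section Growth

/-- The relation between the four corners `ρ, μ, ν, l` of a cell filled with `a` in a Burge-type
growth diagram; `c` is the sequence of carries. -/
structure IsGrowthCell (ρ μ ν l c : ℕ → ℕ) (a : ℕ) : Prop where
  carry : ∀ k, c k = (min (μ k) (ν k) - ρ k) + (c (k + 1) + max (μ (k + 1)) (ν (k + 1)) - ρ k)
  zero : l 0 = max (μ 0) (ν 0) + c 0
  succ : ∀ k, l (k + 1) = min (max (μ (k + 1)) (ν (k + 1)) + c (k + 1)) (ρ k)
  eventually : ∃ K, ∀ k, K ≤ k → c k = a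

/-- Two shapes interlace: their difference is a horizontal strip. -/
def Interlace (ρ μ : ℕ → ℕ) : Prop := ∀ k, ρ k ≤ μ k ∧ μ (k + 1) ≤ ρ k

namespace IsGrowthCell

variable {ρ μ ν l c : ℕ → ℕ} {a : ℕ}

theorem interlace_left (h : IsGrowthCell ρ μ ν l c a) (hμ : Interlace ρ μ) : Interlace μ l := by
  intro k
  have h1 := h.succ k
  have h2 := (hμ k).1
  refine ⟨?_, by omega⟩
  cases k with
  | zero => have := h.zero; omega
  | succ k => have := h.succ k; have := (hμ k).2; omega

theorem interlace_right (h : IsGrowthCell ρ μ ν l c a) (hν : Interlace ρ ν) : Interlace ν l := by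
  intro k
  have h1 := h.succ k
  have h2 := (hν k).1
  refine ⟨?_, by omega⟩
  cases k with
  | zero => have := h.zero; omega
  | succ k => have := h.succ k; have := (hν k).2; omega

theorem sum_range (h : IsGrowthCell ρ μ ν l c a) (hμ : Interlace ρ μ) (hν : Interlace ρ ν)
    (L : ℕ) : ∑ k ∈ Finset.range (L + 1), l k + ∑ k ∈ Finset.range L, ρ k =
      ∑ k ∈ Finset.range L, min (μ k) (ν k) +
        ∑ k ∈ Finset.range (L + 1), max (μ k) (ν k) + c L := by
  induction L with
  | zero => simp [h.zero]
  | succ L ih =>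
    rw [Finset.sum_range_succ l (L + 1), Finset.sum_range_succ ρ,
      Finset.sum_range_succ (fun k => min (μ k) (ν k)) L,
      Finset.sum_range_succ (fun k => max (μ k) (ν k)) (L + 1)]
    have h1 := h.succ L
    have h2 := h.carry L
    have h3 := (hμ L).1
    have h4 := (hν L).1
    omega

theorem carry_eq (h : IsGrowthCell ρ μ ν l c a) (hμ : Interlace ρ μ) (hν : Interlace ρ ν) {k : ℕ}
    (h1 : μ k = 0) (h2 : ν k = 0) : c k = a := by
  have hz : ∀ d, μ (k + d) = 0 ∧ ν (k + d) = 0 ∧ c (k + d) = c k := by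
    intro d
    induction d with
    | zero => exact ⟨h1, h2, rfl⟩
    | succ d ih =>
      obtain ⟨h3, h4, h5⟩ := ih
      have h6 := hμ (k + d)
      have h7 := hν (k + d)
      have h8 := h.carry (k + d)
      rw [← add_assoc]
      omega
  obtain ⟨K, hK⟩ := h.eventually
  rw [← (hz K).2.2]
  exact hK _ (by omega)

theorem pos (h : IsGrowthCell ρ μ ν l c a) (hμ : Interlace ρ μ) (hν : Interlace ρ ν) {k : ℕ}
    (hk : 0 < l k) (h1 : μ k = 0) (h2 : ν k = 0) :
    0 < a ∧ ∀ k', k = k' + 1 → 0 < ρ k' := by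
  have hc := h.carry_eq hμ hν h1 h2
  cases k with
  | zero =>
    have := h.zero
    exact ⟨by omega, fun k' hk' => by omega⟩
  | succ k =>
    have := h.succ k
    refine ⟨by omega, fun k' hk' => ?_⟩
    obtain rfl : k = k' := by omega
    omega

theorem injective {ρ' c' : ℕ → ℕ} {a' : ℕ} (h : IsGrowthCell ρ μ ν l c a)
    (h' : IsGrowthCell ρ' μ ν l c' a') (hμ : Interlace ρ μ) (hν : Interlace ρ ν)
    (hμ' : Interlace ρ' μ) (hν' : Interlace ρ' ν) : ρ = ρ' ∧ a = a' := by
  have step : ∀ k, c k = c' k → ρ k = ρ' k ∧ c (k + 1) = c' (k + 1) := by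
    intro k hk
    have h1 := h.carry k
    have h2 := h'.carry k
    have h3 := h.succ k
    have h4 := h'.succ k
    have h5 := (hμ k).1
    have h6 := (hν k).1
    have h7 := (hμ' k).1
    have h8 := (hν' k).1
    omega
  have hc : ∀ k, c k = c' k := by
    intro k
    induction k with
    | zero => have := h.zero; have := h'.zero; omega
    | succ k ih => exact (step k ih).2
  refine ⟨funext fun k => (step k (hc k)).1, ?_⟩
  obtain ⟨K, hK⟩ := h.eventually
  obtain ⟨K', hK'⟩ := h'.eventually
  rw [← hK (max K K') (le_max_left _ _), hc, hK' _ (le_max_right _ _)]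

end IsGrowthCell

/-- The carries of a growth cell, computed downwards from a position where they equal `a`; the
first argument is the distance to that position. -/
def growthCarry (ρ μ ν : ℕ → ℕ) (a : ℕ) : ℕ → ℕ → ℕ
  | 0, _ => a
  | d + 1, k => (min (μ k) (ν k) - ρ k) +
      (growthCarry ρ μ ν a d (k + 1) + max (μ (k + 1)) (ν (k + 1)) - ρ k)

/-- The fourth corner of a growth cell. -/
def growthStep (K : ℕ) (ρ μ ν : ℕ → ℕ) (a : ℕ) : ℕ → ℕ
  | 0 => max (μ 0) (ν 0) + growthCarry ρ μ ν a K 0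
  | k + 1 => min (max (μ (k + 1)) (ν (k + 1)) + growthCarry ρ μ ν a (K - (k + 1)) (k + 1)) (ρ k)

theorem isGrowthCell_growthStep {K : ℕ} {ρ μ ν : ℕ → ℕ} (a : ℕ) (hμ : ∀ k, K ≤ k → μ k = 0)
    (hν : ∀ k, K < k → ν k = 0) (hρ : ∀ k, K ≤ k → ρ k = 0) :
    IsGrowthCell ρ μ ν (growthStep K ρ μ ν a) (fun k => growthCarry ρ μ ν a (K - k) k) a where
  carry k := by
    by_cases hk : k < K
    · rw [show K - k = (K - (k + 1)) + 1 by omega]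
      rfl
    · have h1 := hμ k (by omega)
      have h2 := hμ (k + 1) (by omega)
      have h3 := hν (k + 1) (by omega)
      have h4 := hρ k (by omega)
      rw [show K - k = 0 by omega, show K - (k + 1) = 0 by omega]
      simp [growthCarry, h1, h2, h3, h4]
  zero := rfl
  succ k := rfl
  eventually := ⟨K, fun k hk => by simp [show K - k = 0 by omega, growthCarry]⟩

/-- The shapes of the growth diagram of the nonnegative integer matrix `m`. -/
def growth (m : ℕ → ℕ → ℕ) : ℕ → ℕ → ℕ → ℕ
  | 0, _ => 0
  | _ + 1, 0 => 0
  | i + 1, j + 1 =>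
    growthStep i (growth m i j) (growth m i (j + 1)) (growth m (i + 1) j) (m i j)

variable (m : ℕ → ℕ → ℕ)

theorem growth_zero_left (j : ℕ) : growth m 0 j = 0 := by rw [growth]

theorem growth_zero_right (i : ℕ) : growth m i 0 = 0 := by cases i <;> rw [growth]

theorem growth_eq_zero_of_le {i k : ℕ} (hk : i ≤ k) (j : ℕ) : growth m i j k = 0 := by
  induction i generalizing j k with
  | zero => rw [growth_zero_left]; rfl
  | succ i ih =>
    cases j with
    | zero => rw [growth_zero_right]; rfl
    | succ j =>
      obtain ⟨k, rfl⟩ : ∃ k', k = k' + 1 := ⟨k - 1, by omega⟩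
      rw [growth, growthStep, ih (Nat.le_of_succ_le_succ hk) j, Nat.min_zero]

theorem exists_isGrowthCell_growth (i j : ℕ) : ∃ c, IsGrowthCell (growth m i j)
    (growth m i (j + 1)) (growth m (i + 1) j) (growth m (i + 1) (j + 1)) c (m i j) := by
  rw [growth.eq_3]
  exact ⟨_, isGrowthCell_growthStep _ (fun k hk => growth_eq_zero_of_le m hk _)
    (fun k hk => growth_eq_zero_of_le m hk _) (fun k hk => growth_eq_zero_of_le m hk _)⟩

theorem interlace_growth (i j : ℕ) : Interlace (growth m i j) (growth m (i + 1) j) ∧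
    Interlace (growth m i j) (growth m i (j + 1)) := by
  have hzero : Interlace (0 : ℕ → ℕ) 0 := fun k => ⟨le_rfl, le_rfl⟩
  suffices ∀ i, (∀ j, Interlace (growth m i j) (growth m i (j + 1))) →
      ∀ j, Interlace (growth m i j) (growth m (i + 1) j) ∧
        Interlace (growth m (i + 1) j) (growth m (i + 1) (j + 1)) by
    have hH : ∀ i j, Interlace (growth m i j) (growth m i (j + 1)) := by
      intro i
      induction i with
      | zero => intro j; simpa only [growth_zero_left] using hzero
      | succ i ih => exact fun j => (this i ih j).2
    exact ⟨(this i (hH i) j).1, hH i j⟩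
  intro i hi
  have hV : ∀ j, Interlace (growth m i j) (growth m (i + 1) j) := by
    intro j
    induction j with
    | zero => simpa only [growth_zero_right] using hzero
    | succ j ih =>
      obtain ⟨c, hc⟩ := exists_isGrowthCell_growth m i j
      exact hc.interlace_left (hi j)
  refine fun j => ⟨hV j, ?_⟩
  obtain ⟨c, hc⟩ := exists_isGrowthCell_growth m i j
  exact hc.interlace_right (hV j)

theorem sum_growth {i L : ℕ} (hL : i ≤ L) (j : ℕ) : ∑ k ∈ Finset.range L, growth m i j k =
    ∑ i' ∈ Finset.range i, ∑ j' ∈ Finset.range j, m i' j' := by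
  have hL' : ∀ {i L : ℕ}, i ≤ L → ∀ j, ∑ k ∈ Finset.range (L + 1), growth m i j k =
      ∑ k ∈ Finset.range L, growth m i j k := by
    intro i L h j
    rw [Finset.sum_range_succ, growth_eq_zero_of_le m h, add_zero]
  induction i generalizing j with
  | zero => simp [growth_zero_left]
  | succ i ih =>
    induction j with
    | zero => simp [growth_zero_right]
    | succ j ihj =>
      obtain ⟨c, hc⟩ := exists_isGrowthCell_growth m i j
      have hs := hc.sum_range (interlace_growth m i j).2 (interlace_growth m i j).1 L
      have hmm : ∑ k ∈ Finset.range L, min (growth m i (j + 1) k) (growth m (i + 1) j k) +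
          ∑ k ∈ Finset.range L, max (growth m i (j + 1) k) (growth m (i + 1) j k) =
          ∑ k ∈ Finset.range L, growth m i (j + 1) k +
          ∑ k ∈ Finset.range L, growth m (i + 1) j k := by
        rw [← Finset.sum_add_distrib, ← Finset.sum_add_distrib]
        exact Finset.sum_congr rfl fun k _ => min_add_max _ _
      have hcL : c L = m i j := hc.carry_eq (interlace_growth m i j).2 (interlace_growth m i j).1
        (growth_eq_zero_of_le m (by omega) _) (growth_eq_zero_of_le m (by omega) _)
      have hmax : max (growth m i (j + 1) L) (growth m (i + 1) j L) = 0 := by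
        rw [growth_eq_zero_of_le m (by omega), growth_eq_zero_of_le m (by omega), max_self]
      rw [hL' hL, Finset.sum_range_succ _ L, hmax, add_zero, hcL, hmm, ih (by omega), ih (by omega),
        ihj] at hs
      simp only [Finset.sum_range_succ, Finset.sum_add_distrib] at hs ⊢
      omega

theorem exists_chain_of_growth_pos {i j k : ℕ} (h : 0 < growth m i j k) :
    ∃ ro co : ℕ → ℕ, (∀ a, a < k → ro a < ro (a + 1) ∧ co a < co (a + 1)) ∧
      ∀ a, a ≤ k → ro a < i ∧ co a < j ∧ 0 < m (ro a) (co a) := by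
  induction i generalizing j k with
  | zero => simp [growth_zero_left] at h
  | succ i ih =>
    induction j with
    | zero => simp [growth_zero_right] at h
    | succ j ihj =>
      obtain ⟨c, hc⟩ := exists_isGrowthCell_growth m i j
      rcases Nat.eq_zero_or_pos (growth m i (j + 1) k) with h1 | h1
      · rcases Nat.eq_zero_or_pos (growth m (i + 1) j k) with h2 | h2
        · obtain ⟨ha, hρ⟩ := hc.pos (interlace_growth m i j).2 (interlace_growth m i j).1 h h1 h2
          cases k with
          | zero =>
            exact ⟨fun _ => i, fun _ => j, by simp,
              fun a _ => ⟨Nat.lt_succ_self i, Nat.lt_succ_self j, ha⟩⟩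
          | succ k =>
            obtain ⟨ro, co, hlt, hm⟩ := ih (hρ k rfl)
            refine ⟨fun a => if a ≤ k then ro a else i, fun a => if a ≤ k then co a else j,
              fun a hak => ?_, fun a hak => ?_⟩
            · rcases Nat.lt_or_ge a k with hak' | hak'
              · simpa [hak'.le, Nat.succ_le_iff.mpr hak'] using hlt a hak'
              · obtain rfl : a = k := by omega
                simpa using ⟨(hm a le_rfl).1, (hm a le_rfl).2.1⟩
            · by_cases hak' : a ≤ k
              · obtain ⟨h3, h4, h5⟩ := hm a hak'
                simp only [hak', if_true]
                exact ⟨by omega, by omega, h5⟩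
              · simpa [hak'] using ha
        · obtain ⟨ro, co, hlt, hm⟩ := ihj h2
          exact ⟨ro, co, hlt, fun a ha => ⟨(hm a ha).1, by have := (hm a ha).2.1; omega,
            (hm a ha).2.2⟩⟩
      · obtain ⟨ro, co, hlt, hm⟩ := ih h1
        exact ⟨ro, co, hlt, fun a ha => ⟨by have := (hm a ha).1; omega, (hm a ha).2⟩⟩

variable {m}

theorem eq_of_growth_eq {m' : ℕ → ℕ → ℕ} {n : ℕ} (h1 : ∀ i ≤ n, growth m i n = growth m' i n)
    (h2 : ∀ j ≤ n, growth m n j = growth m' n j) {i j : ℕ} (hi : i < n) (hj : j < n) :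
    m i j = m' i j := by
  have step : ∀ i j, growth m i (j + 1) = growth m' i (j + 1) →
      growth m (i + 1) j = growth m' (i + 1) j →
      growth m (i + 1) (j + 1) = growth m' (i + 1) (j + 1) →
      growth m i j = growth m' i j ∧ m i j = m' i j := by
    intro i j h3 h4 h5
    obtain ⟨c, hc⟩ := exists_isGrowthCell_growth m i j
    obtain ⟨c', hc'⟩ := exists_isGrowthCell_growth m' i j
    have h6 := interlace_growth m i j
    have h7 := interlace_growth m' i j
    rw [← h3, ← h4] at h7
    rw [← h3, ← h4, ← h5] at hc'
    exact hc.injective hc' h6.2 h6.1 h7.2 h7.1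
  have key : ∀ d e, d ≤ n → e ≤ n → growth m (n - d) (n - e) = growth m' (n - d) (n - e) := by
    intro d
    induction d with
    | zero => exact fun e _ _ => h2 _ (by omega)
    | succ d ih =>
      intro e hd he
      induction e with
      | zero => exact h1 _ (by omega)
      | succ e ihe =>
        have h3 := ihe (by omega)
        have h4 := ih (e + 1) (by omega) he
        have h5 := ih e (by omega) (by omega)
        rw [show n - e = n - (e + 1) + 1 by omega] at h3 h5
        rw [show n - d = n - (d + 1) + 1 by omega] at h4 h5
        exact (step _ _ h3 h4 h5).1
  have key' : ∀ i j, i ≤ n → j ≤ n → growth m i j = growth m' i j := by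
    intro i j hi hj
    have := key (n - i) (n - j) (by omega) (by omega)
    rwa [Nat.sub_sub_self hi, Nat.sub_sub_self hj] at this
  exact (step i j (key' _ _ (by omega) (by omega)) (key' _ _ (by omega) (by omega))
    (key' _ _ (by omega) (by omega))).2

end Growth

section Tableau

theorem lt_count_iff {p : ℕ → Prop} [DecidablePred p] (hp : ∀ i, p (i + 1) → p i) {n x : ℕ} :
    x < Nat.count p n ↔ x < n ∧ p x := by
  have hp' : ∀ d i, p (i + d) → p i := by
    intro d
    induction d with
    | zero => exact fun i h => h
    | succ d ih => exact fun i h => ih i (hp _ h)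
  induction n generalizing x with
  | zero => simp
  | succ n ih =>
    rw [Nat.count_succ]
    by_cases hn : p n
    · have hall : Nat.count p n = n := by
        refine le_antisymm (Nat.count_le _) (Nat.le_of_not_lt fun h => lt_irrefl (Nat.count p n) ?_)
        exact ih.mpr ⟨h, hp' (n - Nat.count p n) _ (by rwa [Nat.add_sub_cancel' h.le])⟩
      rw [if_pos hn, hall]
      refine ⟨fun h => ⟨h, hp' (n - x) _ (by rwa [Nat.add_sub_cancel' (by omega)])⟩, fun h => h.1⟩
    · rw [if_neg hn, add_zero]
      refine (ih (x := x)).trans ⟨fun h => ⟨by omega, h.2⟩,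
        fun h => ⟨lt_of_le_of_ne (by omega) ?_, h.2⟩⟩
      rintro rfl
      exact hn h.2

theorem sum_ite_lt {T s : ℕ} (h : s ≤ T) :
    ∑ a ∈ Finset.range T, (if a < s then 1 else 0) = s := by
  rw [← Finset.card_filter]
  conv_rhs => rw [← Finset.card_range s]
  congr 1
  ext a
  simp only [Finset.mem_filter, Finset.mem_range]
  omega

/-- A chain of shapes, each differing from the previous one by a horizontal strip. -/
structure IsTableau (l : ℕ → ℕ → ℕ) : Prop where
  zero : l 0 = 0
  interlace : ∀ i, Interlace (l i) (l (i + 1))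

/-- The number of the first `n` parts of `s` exceeding `a`. -/
def columnLength (n : ℕ) (s : ℕ → ℕ) (a : ℕ) : ℕ := Nat.count (fun c => a < s c) n

/-- The entry in column `a` and row `c` of the tableau `l`. -/
def tableauEntry (n : ℕ) (l : ℕ → ℕ → ℕ) (a c : ℕ) : ℕ := Nat.count (fun i => l (i + 1) c ≤ a) n

namespace IsTableau

variable {l : ℕ → ℕ → ℕ} {n a c i : ℕ}

theorem antitone (hl : IsTableau l) (i : ℕ) : Antitone (l i) := by
  refine antitone_nat_of_succ_le fun c => ?_
  cases i with
  | zero => rw [hl.zero]; exact le_rfl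
  | succ i => exact (hl.interlace i c).2.trans (hl.interlace i c).1

theorem monotone (hl : IsTableau l) (c : ℕ) : Monotone fun i => l i c :=
  monotone_nat_of_le_succ fun i => (hl.interlace i c).1

theorem lt_columnLength_iff (hl : IsTableau l) : c < columnLength n (l n) a ↔ c < n ∧ a < l n c :=
  lt_count_iff fun c h => h.trans_le (hl.antitone n (Nat.le_succ c))

theorem lt_tableauEntry_iff (hl : IsTableau l) : i < tableauEntry n l a c ↔ i < n ∧ l (i + 1) c ≤ a :=
  lt_count_iff fun i h => (hl.monotone c (Nat.le_succ (i + 1))).trans h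

theorem tableauEntry_lt_iff (hl : IsTableau l) (hi : i ≤ n) :
    tableauEntry n l a c < i ↔ a < l i c := by
  cases i with
  | zero => simp [hl.zero]
  | succ i =>
    have := hl.lt_tableauEntry_iff (n := n) (a := a) (c := c) (i := i)
    omega

theorem tableauEntry_lt (hl : IsTableau l) (h : a < l n c) : tableauEntry n l a c < n :=
  (hl.tableauEntry_lt_iff le_rfl).mpr h

theorem tableauEntry_lt_succ (hl : IsTableau l) (h : a < l n (c + 1)) :
    tableauEntry n l a c < tableauEntry n l a (c + 1) := by
  have h' : a < l n c := h.trans_le (hl.antitone n (Nat.le_succ c))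
  have h1 := hl.tableauEntry_lt h'
  refine hl.lt_tableauEntry_iff.mpr ⟨h1, ((hl.interlace _ c).2).trans ?_⟩
  by_contra hlt
  exact lt_irrefl _ ((hl.tableauEntry_lt_iff h1.le).mpr (not_le.mp hlt))

theorem sum_columnLength (hl : IsTableau l) : ∑ a ∈ Finset.range (l n 0), columnLength n (l n) a =
    ∑ c ∈ Finset.range n, l n c := by
  simp_rw [columnLength, Nat.count_eq_card_filter_range, Finset.card_filter]
  rw [Finset.sum_comm]
  exact Finset.sum_congr rfl fun c _ => sum_ite_lt (hl.antitone n (Nat.zero_le c))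

theorem sum_sum_tableauEntry (hl : IsTableau l) (hi : i ≤ n) {x : ℕ} (hx : x < n) :
    ∑ a ∈ Finset.range (l n 0), ∑ c ∈ Finset.range (columnLength n (l n) a),
      (if tableauEntry n l a c < i ∧ c ≤ x then 1 else 0) = ∑ c ∈ Finset.range (x + 1), l i c := by
  have h1 : ∀ a, ∑ c ∈ Finset.range (columnLength n (l n) a),
      (if tableauEntry n l a c < i ∧ c ≤ x then 1 else 0) =
      ∑ c ∈ Finset.range (x + 1), (if a < l i c then 1 else 0) := by
    intro a
    rw [← Finset.card_filter, ← Finset.card_filter]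
    congr 1
    ext c
    simp only [Finset.mem_filter, Finset.mem_range, hl.lt_columnLength_iff]
    have h2 : l i c ≤ l n c := hl.monotone c hi
    constructor
    · rintro ⟨⟨-, h⟩, h', h''⟩
      exact ⟨by omega, (hl.tableauEntry_lt_iff hi).mp h'⟩
    · rintro ⟨h, h'⟩
      exact ⟨⟨by omega, by omega⟩, (hl.tableauEntry_lt_iff hi).mpr h', by omega⟩
  simp_rw [h1]
  rw [Finset.sum_comm]
  exact Finset.sum_congr rfl fun c _ =>
    sum_ite_lt ((hl.antitone i (Nat.zero_le c)).trans (hl.monotone 0 hi))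

end IsTableau

theorem isTableau_growth_left (m : ℕ → ℕ → ℕ) (n : ℕ) : IsTableau fun i => growth m i n :=
  ⟨growth_zero_left m n, fun i => (interlace_growth m i n).1⟩

theorem isTableau_growth_right (m : ℕ → ℕ → ℕ) (n : ℕ) : IsTableau fun j => growth m n j :=
  ⟨growth_zero_right m n, fun j => (interlace_growth m n j).2⟩

end Tableau

section Encoding

/-- The data of a minor of size at most `r`. -/
structure MinorDatum (n r : ℕ) where
  /-- The size. -/
  len : ℕ
  len_le : len ≤ r
  /-- The rows. -/
  row : Fin len → Fin n
  /-- The columns. -/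
  col : Fin len → Fin n
  row_strictMono : StrictMono row
  col_strictMono : StrictMono col

/-- The minor with the given datum. -/
noncomputable def MinorDatum.minor {k A : Type*} [Field k] [Ring A] [Algebra k A] {n r : ℕ}
    (D : MinorDatum n r) (q : k) (z : Fin n → Fin n → A) : A := qdet q z D.row D.col

/-- The leading exponent of the minor with the given datum. -/
noncomputable def MinorDatum.exp {n r : ℕ} (D : MinorDatum n r) : VarIdx →₀ ℕ :=
  minorExp D.row D.col

theorem strictMono_tableauEntry {l : ℕ → ℕ → ℕ} (hl : IsTableau l) {n a t : ℕ}
    (ht : ∀ c, c < t → a < l n c) : StrictMono fun c : Fin t =>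
      (⟨tableauEntry n l a c, hl.tableauEntry_lt (ht c c.isLt)⟩ : Fin n) := by
  have key : ∀ d c, c + d + 1 < t → tableauEntry n l a c < tableauEntry n l a (c + d + 1) := by
    intro d
    induction d with
    | zero => exact fun c h => hl.tableauEntry_lt_succ (ht _ h)
    | succ d ih =>
      intro c h
      exact (ih c (by omega)).trans (hl.tableauEntry_lt_succ (ht _ h))
  intro c d hcd
  have h := key (d - c - 1) c
  have hcd' : (c : ℕ) < d := hcd
  rw [show (c : ℕ) + (d - c - 1) + 1 = d by omega] at h
  exact h d.isLt

/-- The minors read off from the columns of the two tableaux of the growth diagram of `m`. -/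
def growthMinor (m : ℕ → ℕ → ℕ) {n r : ℕ} (h : growth m n n r = 0) (a : ℕ) : MinorDatum n r where
  len := columnLength n (growth m n n) a
  len_le := by
    by_contra hr
    have := ((isTableau_growth_left m n).lt_columnLength_iff.mp (not_le.mp hr)).2
    omega
  row c := ⟨tableauEntry n (fun i => growth m i n) a c, (isTableau_growth_left m n).tableauEntry_lt
    ((isTableau_growth_left m n).lt_columnLength_iff.mp c.isLt).2⟩
  col c := ⟨tableauEntry n (fun j => growth m n j) a c, (isTableau_growth_right m n).tableauEntry_lt
    ((isTableau_growth_right m n).lt_columnLength_iff.mp c.isLt).2⟩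
  row_strictMono := strictMono_tableauEntry (isTableau_growth_left m n) fun _ hc =>
    ((isTableau_growth_left m n).lt_columnLength_iff.mp hc).2
  col_strictMono := strictMono_tableauEntry (isTableau_growth_right m n) fun _ hc =>
    ((isTableau_growth_right m n).lt_columnLength_iff.mp hc).2

/-- The list of minors associated with `m`. -/
def growthMinors (m : ℕ → ℕ → ℕ) {n r : ℕ} (h : growth m n n r = 0) : List (MinorDatum n r) :=
  (List.range (growth m n n 0)).map (growthMinor m h)

variable {m : ℕ → ℕ → ℕ} {n r : ℕ}

theorem sum_len_growthMinors (h : growth m n n r = 0) :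
    ((growthMinors m h).map MinorDatum.len).sum =
      ∑ i ∈ Finset.range n, ∑ j ∈ Finset.range n, m i j := by
  rw [growthMinors, List.map_map, ← List.sum_toFinset _ List.nodup_range, List.toFinset_range,
    ← sum_growth m le_rfl]
  exact (isTableau_growth_left m n).sum_columnLength

theorem sum_range_sum_ite {t x i : ℕ} (f : ℕ → ℕ) (hx : x < n) :
    ∑ i' ∈ Finset.range i, ∑ c : Fin t,
      (if f c + n = x + (i' + n - x - 1) + 1 ∧ (c : ℕ) ≤ x then 1 else 0) =
    ∑ c ∈ Finset.range t, (if f c < i ∧ c ≤ x then 1 else 0) := by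
  rw [Finset.sum_comm, Finset.sum_range]
  refine Finset.sum_congr rfl fun c _ => ?_
  rw [← Finset.card_filter]
  split_ifs with h
  · rw [Finset.card_eq_one]
    refine ⟨f c, ?_⟩
    ext i'
    simp only [Finset.mem_filter, Finset.mem_range, Finset.mem_singleton]
    omega
  · rw [Finset.card_eq_zero, Finset.filter_eq_empty_iff]
    intro i' hi'
    rw [Finset.mem_range] at hi'
    omega

theorem sum_exp_growthMinors_apply (h : growth m n n r = 0) (y : VarIdx) :
    ((growthMinors m h).map MinorDatum.exp).sum y =
      ∑ a ∈ Finset.range (growth m n n 0), (growthMinor m h a).exp y := by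
  rw [growthMinors, List.map_map, ← List.sum_toFinset _ List.nodup_range, List.toFinset_range,
    Finsupp.finsetSum_apply]
  rfl

theorem sum_exp_growthMinors_false (hrn : r ≤ n) (h : growth m n n r = 0) {i x : ℕ} (hi : i ≤ n)
    (hx : x < n) : ∑ i' ∈ Finset.range i,
      ((growthMinors m h).map MinorDatum.exp).sum (false, true, i' + n - x - 1, x) =
      ∑ c ∈ Finset.range (x + 1), growth m i n c := by
  rw [← (isTableau_growth_left m n).sum_sum_tableauEntry hi hx]
  simp_rw [sum_exp_growthMinors_apply]
  rw [Finset.sum_comm]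
  refine Finset.sum_congr rfl fun a _ => ?_
  simp_rw [MinorDatum.exp, minorExp_apply_false ((growthMinor m h a).len_le.trans hrn)]
  exact sum_range_sum_ite (tableauEntry n (fun i => growth m i n) a) hx

theorem sum_exp_growthMinors_true (hrn : r ≤ n) (h : growth m n n r = 0) {j x : ℕ} (hj : j ≤ n)
    (hx : x < n) : ∑ j' ∈ Finset.range j,
      ((growthMinors m h).map MinorDatum.exp).sum (true, true, j' + n - x - 1, x) =
      ∑ c ∈ Finset.range (x + 1), growth m n j c := by
  rw [← (isTableau_growth_right m n).sum_sum_tableauEntry hj hx]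
  simp_rw [sum_exp_growthMinors_apply]
  rw [Finset.sum_comm]
  refine Finset.sum_congr rfl fun a _ => ?_
  simp_rw [MinorDatum.exp, minorExp_apply_true ((growthMinor m h a).len_le.trans hrn)]
  exact sum_range_sum_ite (tableauEntry n (fun j => growth m n j) a) hx

theorem eq_of_sum_range_succ_eq {f g : ℕ → ℕ} (hfg : ∀ x < n, ∑ c ∈ Finset.range (x + 1), f c =
    ∑ c ∈ Finset.range (x + 1), g c) {x : ℕ} (hx : x < n) : f x = g x := by
  have h1 := hfg x hx
  cases x with
  | zero => simpa using h1
  | succ x =>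
    rw [Finset.sum_range_succ, Finset.sum_range_succ _ (x + 1), hfg x (by omega)] at h1
    exact Nat.add_left_cancel h1

theorem eq_of_sum_exp_growthMinors_eq {m' : ℕ → ℕ → ℕ} (hrn : r ≤ n) (h : growth m n n r = 0)
    (h' : growth m' n n r = 0) (heq : ((growthMinors m h).map MinorDatum.exp).sum =
      ((growthMinors m' h').map MinorDatum.exp).sum) {i j : ℕ} (hi : i < n) (hj : j < n) :
    m i j = m' i j := by
  refine eq_of_growth_eq (n := n) (fun i hi => ?_) (fun j hj => ?_) hi hj
  · funext x
    by_cases hx : x < n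
    · refine eq_of_sum_range_succ_eq (n := n) (fun x hx => ?_) hx
      rw [← sum_exp_growthMinors_false hrn h hi hx, heq, sum_exp_growthMinors_false hrn h' hi hx]
    · rw [growth_eq_zero_of_le m (by omega), growth_eq_zero_of_le m' (by omega)]
  · funext x
    by_cases hx : x < n
    · refine eq_of_sum_range_succ_eq (n := n) (fun x hx => ?_) hx
      rw [← sum_exp_growthMinors_true hrn h hj hx, heq, sum_exp_growthMinors_true hrn h' hj hx]
    · rw [growth_eq_zero_of_le m (by omega), growth_eq_zero_of_le m' (by omega)]

/-- The multiplicity matrix of a multiset of positions. -/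
noncomputable def countMatrix (m : Multiset (Fin n × Fin n)) (i j : ℕ) : ℕ := by
  classical
  exact if h : i < n ∧ j < n then m.count (⟨i, h.1⟩, ⟨j, h.2⟩) else 0

theorem countMatrix_apply [DecidableEq (Fin n × Fin n)] (m : Multiset (Fin n × Fin n))
    (i j : Fin n) : countMatrix m i j = m.count (i, j) := by
  rw [countMatrix, dif_pos ⟨i.isLt, j.isLt⟩]
  congr

theorem sum_countMatrix (m : Multiset (Fin n × Fin n)) :
    ∑ i ∈ Finset.range n, ∑ j ∈ Finset.range n, countMatrix m i j = Multiset.card m := by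
  classical
  rw [Finset.sum_range]
  simp_rw [Finset.sum_range, countMatrix_apply]
  rw [← Fintype.sum_prod_type (f := fun p : Fin n × Fin n => m.count p)]
  exact Multiset.sum_count_eq_card fun a _ => Finset.mem_univ a

theorem growth_countMatrix_eq_zero {m : Multiset (Fin n × Fin n)} (hm : ¬ HasChain (r + 1) m) :
    growth (countMatrix m) n n r = 0 := by
  classical
  by_contra h
  obtain ⟨ro, co, hlt, hpos⟩ := exists_chain_of_growth_pos _ (Nat.pos_of_ne_zero h)
  refine hm ⟨fun a => ⟨ro a, (hpos a (by omega)).1⟩, fun a => ⟨co a, (hpos a (by omega)).2.1⟩,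
    Fin.strictMono_iff_lt_succ.mpr fun a => (hlt a a.isLt).1,
    Fin.strictMono_iff_lt_succ.mpr fun a => (hlt a a.isLt).2, fun a => ?_⟩
  have h1 := (hpos a (by omega)).2.2
  rw [← Multiset.count_pos, ← countMatrix_apply]
  exact h1

/-- The list of minors associated with a multiset without long chains. -/
noncomputable def chainFreeMinors (m : {m : Multiset (Fin n × Fin n) // ¬ HasChain (r + 1) m}) :
    List (MinorDatum n r) := growthMinors (countMatrix m.1) (growth_countMatrix_eq_zero m.2)

theorem sum_len_chainFreeMinors (m : {m : Multiset (Fin n × Fin n) // ¬ HasChain (r + 1) m}) :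
    ((chainFreeMinors m).map MinorDatum.len).sum = Multiset.card m.1 := by
  rw [chainFreeMinors, sum_len_growthMinors, sum_countMatrix]

theorem sum_exp_chainFreeMinors_injective (hrn : r ≤ n) :
    Function.Injective fun m : {m : Multiset (Fin n × Fin n) // ¬ HasChain (r + 1) m} =>
      ((chainFreeMinors m).map MinorDatum.exp).sum := by
  classical
  intro m m' h
  refine Subtype.ext (Multiset.ext.mpr fun p => ?_)
  rw [← countMatrix_apply, ← countMatrix_apply]
  exact eq_of_sum_exp_growthMinors_eq hrn _ _ h p.1.isLt p.2.isLt

end Encoding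

section Injectivity

variable {k A B : Type*} [Field k] [Ring A] [Algebra k A] [Ring B] [Algebra k B] {n r : ℕ} {q : k}

theorem eq_zero_of_map_eq_zero {ι M N : Type*} [Fintype ι] [AddCommGroup M] [Module k M]
    [AddCommGroup N] [Module k N] (φ : M →ₗ[k] N) {F : Submodule k M} {w b : ι → M}
    (hw : F ≤ Submodule.span k (Set.range w)) (hb : ∀ i, b i ∈ F)
    (hφ : LinearIndependent k (φ ∘ b)) {x : M} (hx : x ∈ F) (h : φ x = 0) : x = 0 := by
  have hfin : FiniteDimensional k (Submodule.span k (Set.range w)) :=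
    FiniteDimensional.span_of_finite k (Set.finite_range w)
  have hF : FiniteDimensional k F := Submodule.finiteDimensional_of_le hw
  have hle : Submodule.span k (Set.range b) ≤ F :=
    Submodule.span_le.mpr (by rintro _ ⟨i, rfl⟩; exact hb i)
  have heq : Submodule.span k (Set.range b) = F := by
    refine Submodule.eq_of_le_of_finrank_le hle ?_
    rw [finrank_span_eq_card (hφ.of_comp φ)]
    exact (Submodule.finrank_mono hw).trans (finrank_range_le_card w)
  rw [← heq] at hx
  exact Submodule.disjoint_def.mp (Submodule.range_ker_disjoint hφ) x hx h

theorem map_qdet (φ : A →ₐ[k] B) (z : Fin n → Fin n → A) {t : ℕ} (row col : Fin t → Fin n) :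
    φ (qdet q z row col) = qdet q (fun i j => φ (z i j)) row col := by
  simp only [qdet, map_sum, map_smul, map_list_prod, List.map_ofFn]
  rfl

theorem map_wordProd (φ : A →ₐ[k] B) (z : Fin n → Fin n → A) (l : List (Fin n × Fin n)) :
    φ (wordProd z l) = wordProd (fun i j => φ (z i j)) l := by
  simp only [wordProd, map_list_prod, List.map_map]
  rfl

variable (k) in
/-- The span of the products along words of length at most `D`. -/
def wordSpan (z : Fin n → Fin n → A) (D : ℕ) : Submodule k A :=
  Submodule.span k (wordProd z '' {l | l.length ≤ D})

variable {z : Fin n → Fin n → A}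

theorem wordProd_mem_wordSpan {l : List (Fin n × Fin n)} {D : ℕ} (h : l.length ≤ D) :
    wordProd z l ∈ wordSpan k z D :=
  Submodule.subset_span ⟨l, h, rfl⟩

theorem wordSpan_mono {D D' : ℕ} (h : D ≤ D') : wordSpan k z D ≤ wordSpan k z D' :=
  Submodule.span_mono (Set.image_mono fun _ hl => le_trans hl h)

theorem mul_mem_wordSpan {D D' : ℕ} {f g : A} (hf : f ∈ wordSpan k z D)
    (hg : g ∈ wordSpan k z D') : f * g ∈ wordSpan k z (D + D') := by
  have hle : wordSpan k z D * wordSpan k z D' ≤ wordSpan k z (D + D') := by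
    rw [wordSpan, wordSpan, Submodule.span_mul_span, Submodule.span_le]
    rintro _ ⟨_, ⟨l, hl, rfl⟩, _, ⟨l', hl', rfl⟩, rfl⟩
    change wordProd z l * wordProd z l' ∈ wordSpan k z (D + D')
    rw [← wordProd_append]
    refine wordProd_mem_wordSpan ?_
    rw [List.length_append]
    exact Nat.add_le_add hl hl'
  exact hle (Submodule.mul_mem_mul hf hg)

theorem qdet_mem_wordSpan {t : ℕ} (row col : Fin t → Fin n) :
    qdet q z row col ∈ wordSpan k z t := by
  refine Submodule.sum_mem _ fun σ _ => Submodule.smul_mem _ _ ?_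
  have h : (List.ofFn fun a => z (row a) (col (σ a))).prod =
      wordProd z (List.ofFn fun a => (row a, col (σ a))) := by
    rw [wordProd, List.map_ofFn]
    rfl
  rw [h]
  exact wordProd_mem_wordSpan (by simp)

theorem prod_minor_mem_wordSpan (L : List (MinorDatum n r)) :
    (L.map fun D => D.minor q z).prod ∈ wordSpan k z (L.map MinorDatum.len).sum := by
  induction L with
  | nil => exact wordProd_mem_wordSpan (l := []) le_rfl
  | cons D L ih =>
    rw [List.map_cons, List.map_cons, List.prod_cons, List.sum_cons]
    exact mul_mem_wordSpan (qdet_mem_wordSpan _ _) ih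

theorem finite_chainFree (n r D : ℕ) : Finite
    {m : {m : Multiset (Fin n × Fin n) // ¬ HasChain (r + 1) m} // Multiset.card m.1 ≤ D} := by
  classical
  have hfin : Finite {m : Multiset (Fin n × Fin n) // Multiset.card m ≤ D} := by
    refine ((Set.finite_Iic (D • (Finset.univ : Finset (Fin n × Fin n)).val)).subset
      fun m hm => ?_).to_subtype
    refine Multiset.le_iff_count.mpr fun a => ?_
    rw [Multiset.count_nsmul, Multiset.count_eq_one_of_mem Finset.univ.nodup (Finset.mem_univ a),
      mul_one]
    exact (Multiset.count_le_card a m).trans hm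
  refine Finite.of_injective (β := {m : Multiset (Fin n × Fin n) // Multiset.card m ≤ D})
    (fun m => ⟨m.1.1, m.2⟩) fun m m' h => ?_
  exact Subtype.ext (Subtype.ext (Subtype.mk.inj h))

theorem IsQMatrix.wordSpan_le (hq : q ≠ 0) (hz : IsQMatrix q z)
    (h : ∀ ro co : Fin (r + 1) → Fin n, StrictMono ro → StrictMono co → qdet q z ro co = 0)
    (D : ℕ) : wordSpan k z D ≤ Submodule.span k (Set.range fun m :
      {m : {m : Multiset (Fin n × Fin n) // ¬ HasChain (r + 1) m} // Multiset.card m.1 ≤ D} =>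
        wordProd z m.1.1.toList) := by
  rw [wordSpan, Submodule.span_le]
  rintro _ ⟨l, hl, rfl⟩
  refine Submodule.span_mono ?_ (hz.wordProd_mem_span_of_qdet_eq_zero hq h l)
  rintro _ ⟨m, ⟨hm, hm'⟩, rfl⟩
  exact ⟨⟨⟨m, hm'⟩, hm.le.trans hl⟩, rfl⟩

variable {E : (VarIdx →₀ ℕ) → B} {ev : B →ₗ[k] (VarIdx →₀ ℕ) →₀ k}

theorem IsTorusBasis.hasLead_minor [CharZero k] (hE : IsTorusBasis q expForm E ev) (hrn : r ≤ n)
    (D : MinorDatum n r) :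
    HasLead k E (expWeight (2 * n)) (D.minor q (rankMatrix E n r)) D.exp :=
  hE.hasLead_qdet_rankMatrix hrn D.len_le D.row_strictMono D.col_strictMono

theorem IsTorusBasis.map_mem_span (hE : IsTorusBasis q expForm E ev) (φ : A →ₐ[k] B)
    (hφ : ∀ i j, φ (z i j) = rankMatrix E n r i j) {D : ℕ} {x : A} (hx : x ∈ wordSpan k z D) :
    φ x ∈ Submodule.span k (Set.range E) := by
  induction hx using Submodule.span_induction with
  | mem x hx =>
    obtain ⟨l, -, rfl⟩ := hx
    rw [map_wordProd]
    simp_rw [hφ]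
    induction l with
    | nil => exact Submodule.subset_span ⟨0, hE.zero⟩
    | cons p l ih =>
      rw [wordProd, List.map_cons, List.prod_cons]
      exact hE.mul_mem_span (hE.rankMatrix_mem_span _ _ _ _) ih
  | zero => rw [map_zero]; exact zero_mem _
  | add x y _ _ hx hy => rw [map_add]; exact add_mem hx hy
  | smul a x _ hx => rw [map_smul]; exact Submodule.smul_mem _ _ hx

theorem IsTorusBasis.eq_zero_of_map_eq_zero [CharZero k] (hE : IsTorusBasis q expForm E ev)
    (hrn : r ≤ n) (hz : IsQMatrix q z)
    (h : ∀ ro co : Fin (r + 1) → Fin n, StrictMono ro → StrictMono co → qdet q z ro co = 0)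
    (φ : A →ₐ[k] B) (hφ : ∀ i j, φ (z i j) = rankMatrix E n r i j) {D : ℕ} {x : A}
    (hx : x ∈ wordSpan k z D) (hx0 : φ x = 0) : x = 0 := by
  have hfin := finite_chainFree n r D
  have := Fintype.ofFinite
    {m : {m : Multiset (Fin n × Fin n) // ¬ HasChain (r + 1) m} // Multiset.card m.1 ≤ D}
  refine QuantumDet.eq_zero_of_map_eq_zero φ.toLinearMap
    (b := fun m => ((chainFreeMinors m.1).map fun D => D.minor q z).prod)
    (hz.wordSpan_le hE.ne_zero h D) (fun m => ?_) ?_ hx hx0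
  · refine wordSpan_mono ?_ (prod_minor_mem_wordSpan _)
    rw [sum_len_chainFreeMinors]
    exact m.2
  · refine hE.linearIndependent_of_hasLead (w := expWeight (2 * n))
      (e := fun m => ((chainFreeMinors m.1).map MinorDatum.exp).sum)
      ((sum_exp_chainFreeMinors_injective hrn).comp Subtype.val_injective) fun m => ?_
    have hmap : φ (((chainFreeMinors m.1).map fun D => D.minor q z).prod) =
        ((chainFreeMinors m.1).map fun D => D.minor q (rankMatrix E n r)).prod := by
      rw [map_list_prod, List.map_map]
      congr 2
      funext D
      change φ (qdet q z D.row D.col) = _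
      rw [map_qdet]
      simp_rw [hφ]
      rfl
    change HasLead k E _ (φ _) _
    rw [hmap]
    exact hE.hasLead_prod_map _ fun D _ => hE.hasLead_minor hrn D

end Injectivity

section RankAlgebra

variable {k : Type} [Field k] {q : k} {n r : ℕ}

/-- The generators of the algebra of quantum matrices of rank at most `r`. -/
noncomputable def rankGen (k : Type) [Field k] (q : k) (n r : ℕ) (i j : Fin n) :
    QMatRank k q n r :=
  rankProj k q n r (Zgen k q n n i j)

theorem isQMatrix_Zgen : IsQMatrix q (Zgen k q n n) where
  row i j l h := by
    simpa [Zgen] using RingQuot.mkAlgHom_rel k (QMatRel.row (k := k) (q := q) i j l h)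
  col i s j h := by
    simpa [Zgen] using RingQuot.mkAlgHom_rel k (QMatRel.col (k := k) (q := q) i s j h)
  cross i s j l h h' := by
    simpa [Zgen] using RingQuot.mkAlgHom_rel k (QMatRel.cross (k := k) (q := q) i s j l h h')
  diag i s j l h h' := by
    simpa [Zgen] using RingQuot.mkAlgHom_rel k (QMatRel.diag (k := k) (q := q) i s j l h h')

theorem isQMatrix_rankGen : IsQMatrix q (rankGen k q n r) where
  row i j l h := by
    simpa [rankGen] using congrArg (rankProj k q n r) (isQMatrix_Zgen.row i j l h)
  col i s j h := by
    simpa [rankGen] using congrArg (rankProj k q n r) (isQMatrix_Zgen.col i s j h)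
  cross i s j l h h' := by
    simpa [rankGen] using congrArg (rankProj k q n r) (isQMatrix_Zgen.cross i s j l h h')
  diag i s j l h h' := by
    simpa [rankGen] using congrArg (rankProj k q n r) (isQMatrix_Zgen.diag i s j l h h')

theorem rankProj_qMinor {t : ℕ} (row col : Fin t → Fin n) :
    rankProj k q n r (qMinor k q n n t row col) = qdet q (rankGen k q n r) row col :=
  map_qdet (A := QMat k q n n) (B := QMatRank k q n r) (rankProj k q n r) (Zgen k q n n) row col

theorem qdet_rankGen_eq_zero {ro co : Fin (r + 1) → Fin n} (hro : StrictMono ro)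
    (hco : StrictMono co) : qdet q (rankGen k q n r) ro co = 0 := by
  rw [← rankProj_qMinor, ← map_zero (rankProj k q n r)]
  exact RingQuot.mkAlgHom_rel k ⟨⟨ro, co, hro, hco, rfl⟩, rfl⟩

theorem exists_mem_wordSpan_rankGen (x : QMatRank k q n r) :
    ∃ D, x ∈ wordSpan k (rankGen k q n r) D := by
  obtain ⟨y, rfl⟩ := RingQuot.mkAlgHom_surjective k (minorRel k q n (r + 1)) x
  obtain ⟨a, rfl⟩ := RingQuot.mkAlgHom_surjective k (QMatRel k q n n) y
  induction a using FreeAlgebra.induction with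
  | grade0 c =>
    refine ⟨0, ?_⟩
    rw [AlgHom.commutes, AlgHom.commutes, Algebra.algebraMap_eq_smul_one]
    exact Submodule.smul_mem _ _ (wordProd_mem_wordSpan (l := []) le_rfl)
  | grade1 p =>
    refine ⟨1, ?_⟩
    have := wordProd_mem_wordSpan (k := k) (z := rankGen k q n r) (l := [p]) le_rfl
    rwa [wordProd, List.map_singleton, List.prod_singleton] at this
  | mul a b ha hb =>
    obtain ⟨D, ha⟩ := ha
    obtain ⟨D', hb⟩ := hb
    exact ⟨D + D', by rw [map_mul, map_mul]; exact mul_mem_wordSpan ha hb⟩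
  | add a b ha hb =>
    obtain ⟨D, ha⟩ := ha
    obtain ⟨D', hb⟩ := hb
    refine ⟨max D D', ?_⟩
    rw [map_add, map_add]
    exact add_mem (wordSpan_mono (le_max_left _ _) ha) (wordSpan_mono (le_max_right _ _) hb)

theorem exists_algHom_rankGen {B : Type*} [Ring B] [Algebra k B] {w : Fin n → Fin n → B}
    (hw : IsQMatrix q w) (h : ∀ ro co : Fin (r + 1) → Fin n, StrictMono ro → StrictMono co →
      qdet q w ro co = 0) :
    ∃ φ : QMatRank k q n r →ₐ[k] B, ∀ i j, φ (rankGen k q n r i j) = w i j := by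
  let f : FreeAlgebra k (Fin n × Fin n) →ₐ[k] B := FreeAlgebra.lift k fun p => w p.1 p.2
  have hf : ∀ ⦃x y⦄, QMatRel k q n n x y → f x = f y := by
    rintro _ _ (⟨i, j, l, h⟩ | ⟨i, s, j, h⟩ | ⟨i, s, j, l, h, h'⟩ | ⟨i, s, j, l, h, h'⟩)
    · simpa [f] using hw.row i j l h
    · simpa [f] using hw.col i s j h
    · simpa [f] using hw.cross i s j l h h'
    · simpa [f] using hw.diag i s j l h h'
  let g : QMat k q n n →ₐ[k] B := RingQuot.liftAlgHom k ⟨f, hf⟩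
  have hg : ∀ i j, g (Zgen k q n n i j) = w i j := by
    intro i j
    simp [g, f, Zgen, RingQuot.liftAlgHom_mkAlgHom_apply]
  have hg' : ∀ ⦃x y⦄, minorRel k q n (r + 1) x y → g x = g y := by
    rintro _ _ ⟨⟨ro, co, hro, hco, rfl⟩, rfl⟩
    rw [map_zero, ← h ro co hro hco]
    refine (map_qdet g (Zgen k q n n) ro co).trans ?_
    simp_rw [hg]
  refine ⟨RingQuot.liftAlgHom k ⟨g, hg'⟩, fun i j => ?_⟩
  rw [rankGen, rankProj, RingQuot.liftAlgHom_mkAlgHom_apply, hg]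

theorem isRegular_qdet_rankGen [CharZero k] (hq : q ≠ 0) (hrn : r ≤ n) {t : ℕ} (ht : t ≤ r)
    {row col : Fin t → Fin n} (hrow : StrictMono row) (hcol : StrictMono col) :
    IsRegular (qdet q (rankGen k q n r) row col) := by
  have hE := isTorusBasis_torusOp hq expForm
  obtain ⟨φ, hφ⟩ := exists_algHom_rankGen (k := k) (r := r) (hE.isQMatrix_rankMatrix n r)
    fun ro co _ hco => hE.qdet_rankMatrix_eq_zero (Nat.lt_succ_self r) ro hco
  have hlead := hE.hasLead_qdet_rankMatrix hrn ht hrow hcol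
  have hd : φ (qdet q (rankGen k q n r) row col) =
      qdet q (rankMatrix (torusOp q expForm) n r) row col := by
    refine (map_qdet (A := QMatRank k q n r)
      (B := Module.End k ((VarIdx →₀ ℕ) →₀ k)) φ (rankGen k q n r) row col).trans ?_
    simp_rw [hφ]
  have hzero : ∀ x, φ x = 0 → x = 0 := by
    intro x hx
    obtain ⟨D, hD⟩ := exists_mem_wordSpan_rankGen x
    exact hE.eq_zero_of_map_eq_zero hrn isQMatrix_rankGen
      (fun _ _ => qdet_rankGen_eq_zero) φ hφ hD hx
  have hmem : ∀ x, φ x ∈ Submodule.span k (Set.range (torusOp q expForm)) := by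
    intro x
    obtain ⟨D, hD⟩ := exists_mem_wordSpan_rankGen x
    exact hE.map_mem_span φ hφ hD
  refine ⟨isLeftRegular_of_non_zero_divisor _ fun x hx => hzero x ?_,
    isRightRegular_of_non_zero_divisor _ fun x hx => hzero x ?_⟩
  · refine hE.eq_zero_of_mul_eq_zero_left hlead (hmem x) ?_
    rw [← hd, ← map_mul, hx, map_zero]
  · refine hE.eq_zero_of_mul_eq_zero_right hlead (hmem x) ?_
    rw [← hd, ← map_mul, hx, map_zero]

end RankAlgebra

end QuantumDet

/-- Let `k` be a field of characteristic zero, `1 ≤ r ≤ n - 1`, and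
`q ≠ 0` either generic or a primitive `m`-th root of unity.  Then the image of the
quantum determinant `d = d_r` in `M^{r+1}_q(n) = M_q(n)/I^{r+1}_q` is a regular
element (neither a left nor a right zero divisor). -/
theorem rankProj_dMinor_isRegular
    (k : Type) [Field k] [CharZero k] (q : k) (hq0 : q ≠ 0)
    (hq : GenericOrRootOfUnity k q) (n r : ℕ) (hr : 1 ≤ r) (hrn : r + 1 ≤ n) :
    IsRegular (rankProj k q n r (dMinor k q n r (le_of_lt hrn))) := by
  rw [dMinor, QuantumDet.rankProj_qMinor]
  exact QuantumDet.isRegular_qdet_rankGen hq0 (le_of_lt hrn) le_rfl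
    (Fin.strictMono_castLE _) (Fin.strictMono_castLE _)
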